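/- arXiv:1608.00231 — 5 statements merged into one kernel-verified Lean document; each statement's English description precedes it below -/
import Mathlib

section
/- Let G be a finite group whose order is not a power of 2, such that the group algebra ℝ[G] is not reduced (contains a nonzero nilpotent element) and such that some nontrivial normal subgroup of G is a nonideal-kernel witness over ℝ. Then G is generalized dicyclic. -/
open scoped BigOperators

/-- The averaging element `e_N = (1/|N|) ∑_{n ∈ N} n` in the group algebra `K[G]`. -/
noncomputable def aveIdem (K : Type*) [Field K] {G : Type*} [Group G] (N : Subgroup G) :
    MonoidAlgebra K G :=
  (Nat.card N : K)⁻¹ • ∑ᶠ n : N, MonoidAlgebra.of K G (n : G)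

/-- `N` is a nonideal-kernel witness over `K`: every nilpotent element `x` of `K[G]`
satisfies `x * e_N = x`. -/
def IsNKW (K : Type*) [Field K] {G : Type*} [Group G] (N : Subgroup G) : Prop :=
  ∀ x : MonoidAlgebra K G, IsNilpotent x → x * aveIdem K N = x

/-- `G` is generalized dicyclic. -/
def IsGenDicyclic (G : Type*) [Group G] : Prop :=
  (¬ ∀ a b : G, a * b = b * a) ∧
  ∃ (A : Subgroup G) (g : G), (∀ a b : A, a * b = b * a) ∧ A.index = 2 ∧
    g ∉ A ∧ g ^ 2 ≠ 1 ∧ ∀ a ∈ A, g⁻¹ * a * g = a⁻¹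

namespace TwoSidedIdeal

variable {R : Type*} [Ring R] {I : TwoSidedIdeal R}

theorem mul_mem_comm_of_sq_mem (hI : ∀ x, x * x ∈ I → x ∈ I) {a b : R} (h : a * b ∈ I) :
    b * a ∈ I := by
  apply hI
  rw [show b * a * (b * a) = b * (a * b) * a by noncomm_ring]
  exact I.mul_mem_right _ _ (I.mul_mem_left _ _ h)

theorem mul_mul_mem_of_sq_mem (hI : ∀ x, x * x ∈ I → x ∈ I) {a b : R} (r : R) (h : a * b ∈ I) :
    a * r * b ∈ I := by
  apply hI
  rw [show a * r * b * (a * r * b) = a * r * (b * a) * (r * b) by noncomm_ring]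
  exact I.mul_mem_right _ _ (I.mul_mem_left _ _ (mul_mem_comm_of_sq_mem hI h))

theorem mul_commutator_mem_of_sq_mem (hI : ∀ x, x * x ∈ I → x ∈ I) {y s r : R}
    (h : y * s * (s * r - r * s) ∈ I) : y * (s * r - r * s) ∈ I := by
  generalize hu : s * r - r * s = u at h ⊢
  have hsyu : s * y * u ∈ I := by
    have h1 : y * (s * y * u) ∈ I := by
      have := mul_mul_mem_of_sq_mem hI y h
      rwa [show y * s * y * u = y * (s * y * u) by noncomm_ring] at this
    have h2 := mul_mul_mem_of_sq_mem hI s (mul_mem_comm_of_sq_mem hI h1)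
    apply hI
    rw [show s * y * u * (s * y * u) = s * y * u * s * y * u by noncomm_ring]
    exact I.mul_mem_right _ _ h2
  apply hI
  have h1 : y * s * (r * y * u) ∈ I := by
    have := mul_mul_mem_of_sq_mem hI (r * y) h
    rwa [show y * s * (r * y) * u = y * s * (r * y * u) by noncomm_ring] at this
  have h2 : y * r * (s * y * u) ∈ I := I.mul_mem_left _ _ hsyu
  have : y * u * (y * u) = y * s * (r * y * u) - y * r * (s * y * u) := by
    rw [← hu]; noncomm_ring
  rw [this]
  exact I.sub_mem h1 h2

end TwoSidedIdeal

section Group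

variable {G : Type*} [Group G]

theorem not_forall_sq_eq_or_sq_eq {c u v : G} (hc2 : c ^ 2 ≠ 1) (hc4 : c ^ 4 ≠ 1) :
    ¬ ∀ d ∈ Subgroup.zpowers c, d ^ 2 = u ∨ d ^ 2 = v := by
  intro h
  have h0 := h 1 (one_mem _)
  have h1 := h c (Subgroup.mem_zpowers c)
  have h2 := h c⁻¹ (inv_mem (Subgroup.mem_zpowers c))
  rw [one_pow] at h0
  rw [inv_pow] at h2
  have h4 : c ^ 2 ≠ (c ^ 2)⁻¹ := fun h' ↦ hc4 <| by
    rw [show 4 = 2 * 2 from rfl, pow_mul, sq (c ^ 2)]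
    exact mul_eq_one_iff_eq_inv.mpr h'
  have h3 : (c ^ 2)⁻¹ ≠ 1 := inv_ne_one.mpr hc2
  grind

theorem commute_of_forall_conj_eq_or_inv {c : G} (hc : Odd (orderOf c)) (hc1 : c ≠ 1)
    (h : ∀ g k : G, k⁻¹ * g * k = g ∨ k⁻¹ * g * k = g⁻¹) (a b : G) : a * b = b * a := by
  have hsq : ∀ x : G, Commute (c ^ 2) x → Commute c x := by
    intro x hx
    obtain ⟨m, hm⟩ := hc
    have : (c ^ 2) ^ (m + 1) = c := by
      rw [← pow_mul, show 2 * (m + 1) = 2 * m + 1 + 1 by ring, ← hm, pow_succ, pow_orderOf_eq_one,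
        one_mul]
    rw [← this]
    exact hx.pow_left _
  have hc2 : c ^ 2 ≠ 1 := by
    intro h2
    rcases (Nat.dvd_prime Nat.prime_two).mp (orderOf_dvd_of_pow_eq_one h2) with h1 | h1
    · exact hc1 (orderOf_eq_one_iff.mp h1)
    · rw [h1] at hc
      exact absurd hc (by decide)
  have hcomm : ∀ x, Commute c x := by
    intro x
    apply hsq
    rcases h x c with h1 | h1
    · rw [mul_assoc, inv_mul_eq_iff_eq_mul] at h1
      exact Commute.pow_left h1.symm 2
    · rw [mul_assoc, inv_mul_eq_iff_eq_mul] at h1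
      have h2 : x⁻¹ * c = c * x := by
        rw [inv_mul_eq_iff_eq_mul, ← mul_assoc, h1, inv_mul_cancel_right]
      rw [commute_iff_eq, sq, mul_assoc, ← h2, ← mul_assoc, ← mul_assoc, h1]
  rcases h a b with h1 | h1
  · rwa [mul_assoc, inv_mul_eq_iff_eq_mul] at h1
  have hac : b⁻¹ * (a * c) * b = a⁻¹ * c := by
    rw [mul_assoc, mul_assoc a, (hcomm b).eq, ← h1]
    group
  rcases h (a * c) b with h2 | h2 <;> rw [hac] at h2
  · rw [mul_right_cancel h2] at h1
    rwa [mul_assoc, inv_mul_eq_iff_eq_mul] at h1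
  · rw [← (hcomm a).eq, mul_inv_rev] at h2
    exact absurd (by rw [sq, ← eq_inv_iff_mul_eq_one]; exact mul_left_cancel h2) hc2

theorem IsGenDicyclic.of_conj_eq_or_inv_or_sq_eq
    {c w : G} (hc2 : c ^ 2 ≠ 1) (hc4 : c ^ 4 ≠ 1) (hw : w ≠ 1) (hw2 : w ^ 2 = 1)
    (h : ∀ g : G, (∀ k : G, k⁻¹ * g * k = g ∨ k⁻¹ * g * k = g⁻¹) ∨ g ^ 2 = w)
    {g k : G} (hg : k⁻¹ * g * k ≠ g) (hg' : k⁻¹ * g * k ≠ g⁻¹) :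
    IsGenDicyclic G := by
  have hc : ∀ k : G, k⁻¹ * c * k = c ∨ k⁻¹ * c * k = c⁻¹ :=
    (h c).resolve_right fun h' ↦ hc4 (by rw [show 4 = 2 * 2 from rfl, pow_mul, h', hw2])
  have hcomm : ∀ {x d : G}, x ∈ Subgroup.centralizer {c} → d ∈ Subgroup.zpowers c →
      x * d = d * x := by
    rintro x _ hx ⟨n, rfl⟩
    have : Commute x c := Subgroup.mem_centralizer_singleton_iff.mp hx
    exact (this.zpow_right n).eq
  have hinv : ∀ {k d : G}, k ∉ Subgroup.centralizer {c} → d ∈ Subgroup.zpowers c →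
      k⁻¹ * d * k = d⁻¹ := by
    rintro k _ hk ⟨n, rfl⟩
    rcases hc k with h1 | h1
    · refine absurd (Subgroup.mem_centralizer_singleton_iff.mpr ?_) hk
      rw [mul_assoc, inv_mul_eq_iff_eq_mul] at h1
      exact h1.symm
    · have := conj_zpow (a := k⁻¹) (b := c) (i := n)
      rw [inv_inv, h1, inv_zpow] at this
      exact this.symm
  have hab : ∀ {x k : G}, x ∈ Subgroup.centralizer {c} → k ∈ Subgroup.centralizer {c} →
      k⁻¹ * x * k = x := by
    intro x k hx hk
    by_contra hne
    have hy : k⁻¹ * x * k ∈ Subgroup.centralizer {c} := mul_mem (mul_mem (inv_mem hk) hx) hk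
    have hxd : ∀ d ∈ Subgroup.zpowers c, k⁻¹ * (x * d) * k = k⁻¹ * x * k * d := by
      intro d hd
      rw [mul_assoc (k⁻¹ * x), hcomm hk hd]
      group
    generalize k⁻¹ * x * k = y at hne hxd hy
    refine not_forall_sq_eq_or_sq_eq hc2 hc4 (u := y⁻¹ * x⁻¹) (v := (x ^ 2)⁻¹ * w) fun d hd ↦ ?_
    rcases h (x * d) with h1 | h1
    · left
      rcases h1 k with h2 | h2
      · rw [hxd d hd] at h2
        exact absurd (mul_right_cancel h2) hne
      · rw [hxd d hd, mul_inv_rev, hcomm hy hd, eq_inv_mul_iff_mul_eq, ← mul_assoc, ← sq,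
          ← hcomm hy (pow_mem hd 2)] at h2
        rw [← h2, inv_mul_cancel_left]
    · right
      rw [sq, mul_assoc, ← mul_assoc d, ← hcomm hx hd, mul_assoc x, ← mul_assoc x x, ← sq,
        ← sq] at h1
      rw [← h1, inv_mul_cancel_left]
  have hdic : ∀ {x k : G}, x ∈ Subgroup.centralizer {c} → k ∉ Subgroup.centralizer {c} →
      k⁻¹ * x * k = x⁻¹ := by
    intro x k hx hk
    by_contra hne
    have hxd : ∀ d ∈ Subgroup.zpowers c, k⁻¹ * (x * d) * k = k⁻¹ * x * k * d⁻¹ := by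
      intro d hd
      rw [← hinv hk hd]
      group
    generalize k⁻¹ * x * k = y at hne hxd
    refine not_forall_sq_eq_or_sq_eq hc2 hc4 (u := x⁻¹ * y) (v := (x ^ 2)⁻¹ * w) fun d hd ↦ ?_
    rcases h (x * d) with h1 | h1
    · left
      rcases h1 k with h2 | h2
      · rw [hxd d hd] at h2
        rw [mul_inv_eq_iff_eq_mul.mp h2, mul_assoc, inv_mul_cancel_left, sq]
      · rw [hxd d hd, hcomm hx hd, mul_inv_rev] at h2
        exact absurd (mul_right_cancel h2) hne
    · right
      rw [sq, mul_assoc, ← mul_assoc d, ← hcomm hx hd, mul_assoc x, ← mul_assoc x x, ← sq,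
        ← sq] at h1
      rw [← h1, inv_mul_cancel_left]
  have hgC : g ∉ Subgroup.centralizer {c} := by
    intro hgC
    by_cases hk : k ∈ Subgroup.centralizer {c}
    · exact hg (hab hgC hk)
    · exact hg' (hdic hgC hk)
  refine ⟨fun hG ↦ hg (by rw [mul_assoc, hG g, inv_mul_cancel_left]), Subgroup.centralizer {c},
    g, ?_, ?_, hgC, ?_, fun a ha ↦ hdic ha hgC⟩
  · rintro ⟨a, ha⟩ ⟨b, hb⟩
    refine Subtype.ext ?_
    have := hab ha hb
    rw [mul_assoc, inv_mul_eq_iff_eq_mul] at this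
    exact this
  · refine Subgroup.index_eq_two_iff_exists_notMem_and.mpr ⟨g, hgC, fun b ↦ ?_⟩
    by_contra! hb
    refine hb.1 (Subgroup.mem_centralizer_singleton_iff.mpr ?_)
    have hc' := Subgroup.mem_zpowers c
    rw [eq_comm, ← inv_mul_eq_iff_eq_mul, mul_inv_rev,
      show g⁻¹ * b⁻¹ * (c * (b * g)) = g⁻¹ * (b⁻¹ * c * b) * g by group, hinv hb.2 hc',
      hinv hgC (inv_mem hc'), inv_inv]
  · rw [(h g).resolve_left fun h' ↦ (h' k).elim hg hg']
    exact hw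

end Group

open Polynomial in
theorem X_pow_sub_one_sq_eq_prod_quadratic {n : ℕ} (hn : 0 < n) :
    (X ^ n - 1 : ℝ[X]) ^ 2 =
      ∏ ζ ∈ nthRootsFinset n (1 : ℂ), (X ^ 2 - C (2 * ζ.re) * X + 1) := by
  apply map_injective (algebraMap ℝ ℂ) (algebraMap ℝ ℂ).injective
  have hprod := X_pow_sub_one_eq_prod hn (Complex.isPrimitiveRoot_exp n hn.ne')
  have hconj : ∏ ζ ∈ nthRootsFinset n (1 : ℂ), (X - C ζ) =
      ∏ ζ ∈ nthRootsFinset n (1 : ℂ), (X - C (starRingEnd ℂ ζ)) := by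
    refine Finset.prod_nbij' (starRingEnd ℂ) (starRingEnd ℂ) ?_ ?_ ?_ ?_ ?_
    all_goals simp +contextual [mem_nthRootsFinset hn, ← map_pow]
  simp only [Polynomial.map_pow, Polynomial.map_sub, map_X, Polynomial.map_one,
    Polynomial.map_prod, Polynomial.map_add, Polynomial.map_mul, map_C]
  rw [sq]
  nth_rewrite 2 [hprod]
  rw [hconj, hprod, ← Finset.prod_mul_distrib]
  refine Finset.prod_congr rfl fun ζ hζ ↦ ?_
  have hnorm : ζ * starRingEnd ℂ ζ = 1 := by
    have : ‖ζ‖ = 1 := Complex.norm_eq_one_of_pow_eq_one ((mem_nthRootsFinset hn 1).mp hζ) hn.ne'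
    rw [Complex.mul_conj, Complex.normSq_eq_norm_sq, this]
    simp
  have hadd : (algebraMap ℝ ℂ) (2 * ζ.re) = ζ + starRingEnd ℂ ζ := by
    rw [Complex.add_conj]; rfl
  have h1 : C ζ * C (starRingEnd ℂ ζ) = (1 : ℂ[X]) := by rw [← C_mul, hnorm, C_1]
  rw [hadd, C_add]
  linear_combination h1

open Polynomial in
theorem TwoSidedIdeal.add_inv_commutator_mem {R : Type*} [Ring R] [Algebra ℝ R]
    {I : TwoSidedIdeal R} (hI : ∀ x, x * x ∈ I → x ∈ I) {n : ℕ} (hn : 0 < n) {g : Rˣ}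
    (hg : g ^ n = 1) (r : R) :
    (g + ↑g⁻¹ : R) * r - r * (g + ↑g⁻¹) ∈ I := by
  set t : R := g + ↑g⁻¹ with ht
  have key : ∀ (s : Finset ℂ) (y : R),
      y * aeval (g : R) (∏ ζ ∈ s, (X ^ 2 - C (2 * ζ.re) * X + 1 : ℝ[X])) ∈ I →
        y * (t * r - r * t) ∈ I := by
    intro s
    induction s using Finset.induction_on with
    | empty =>
      intro y hy
      rw [Finset.prod_empty, map_one, mul_one] at hy
      exact I.mul_mem_right _ _ hy
    | insert ζ s hζ ih =>
      intro y hy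
      rw [Finset.prod_insert hζ, map_mul, ← mul_assoc] at hy
      have hmem := ih _ hy
      have hfac : aeval (g : R) (X ^ 2 - C (2 * ζ.re) * X + 1 : ℝ[X]) =
          g * (t - algebraMap ℝ R (2 * ζ.re)) := by
        simp only [map_add, map_sub, map_mul, map_pow, aeval_X, aeval_C, map_one]
        rw [mul_sub, ht, mul_add, Units.mul_inv, ← sq, ← map_mul,
          ← Algebra.commutes (2 * ζ.re) (g : R), map_mul]
        abel
      have hcomm : t * r - r * t = (t - algebraMap ℝ R (2 * ζ.re)) * r -
          r * (t - algebraMap ℝ R (2 * ζ.re)) := by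
        rw [sub_mul, mul_sub, Algebra.commutes]
        abel
      rw [hfac, ← mul_assoc] at hmem
      rw [hcomm] at hmem ⊢
      have := mul_mul_mem_of_sq_mem hI (↑g⁻¹ : R) (mul_commutator_mem_of_sq_mem hI hmem)
      rwa [mul_assoc y, Units.mul_inv, mul_one] at this
  rw [← one_mul (t * r - r * t)]
  apply key (nthRootsFinset n (1 : ℂ))
  rw [← X_pow_sub_one_sq_eq_prod_quadratic hn]
  have : (g : R) ^ n = 1 := by rw [← Units.val_pow_eq_pow_val, hg, Units.val_one]
  simp [this, I.zero_mem]

section AveIdem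

variable {K : Type*} [Field K] {G : Type*} [Group G] {N : Subgroup G}

theorem aveIdem_mul_of [Finite G] (z : N) :
    aveIdem K N * MonoidAlgebra.of K G (z : G) = aveIdem K N := by
  have := Fintype.ofFinite N
  rw [aveIdem, finsum_eq_sum_of_fintype, smul_mul_assoc, Finset.sum_mul]
  congr 1
  exact Fintype.sum_equiv (Equiv.mulRight z) _ _ fun n ↦ by simp

theorem aveIdem_mul_self [CharZero K] [Finite G] : aveIdem K N * aveIdem K N = aveIdem K N := by
  have := Fintype.ofFinite N
  nth_rewrite 2 [aveIdem]
  rw [finsum_eq_sum_of_fintype, mul_smul_comm, Finset.mul_sum,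
    Finset.sum_congr rfl fun n _ ↦ aveIdem_mul_of n, Finset.sum_const, Finset.card_univ,
    ← Nat.card_eq_fintype_card, ← Nat.cast_smul_eq_nsmul K, smul_smul,
    inv_mul_cancel₀ (Nat.cast_ne_zero.mpr Nat.card_pos.ne'), one_smul]

theorem commute_aveIdem [N.Normal] [Finite G] (x : MonoidAlgebra K G) :
    Commute (aveIdem K N) x := by
  have := Fintype.ofFinite N
  induction x using MonoidAlgebra.induction_on with
  | of g =>
    rw [commute_iff_eq, aveIdem, finsum_eq_sum_of_fintype, smul_mul_assoc, mul_smul_comm,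
      Finset.sum_mul, Finset.mul_sum]
    congr 1
    refine Fintype.sum_equiv (MulAut.conjNormal g⁻¹).toEquiv _ _ fun n ↦ ?_
    rw [← map_mul, ← map_mul]
    congr 1
    simp [mul_assoc]
  | add x y hx hy => exact hx.add_right hy
  | smul r x hx => exact hx.smul_right r

/-- The two-sided ideal `e_N * K[G]`, the kernel of multiplication by `1 - e_N`. -/
noncomputable def aveIdemIdeal (K : Type*) [Field K] {G : Type*} [Group G] [Finite G] (N : Subgroup G)
    [N.Normal] : TwoSidedIdeal (MonoidAlgebra K G) :=
  .mk' {x | x * aveIdem K N = x} (zero_mul _)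
    (fun {x y} hx hy ↦ by rw [Set.mem_ofPred_eq] at *; rw [add_mul, hx, hy])
    (fun {x} hx ↦ by rw [Set.mem_ofPred_eq] at *; rw [neg_mul, hx])
    (fun {x y} hy ↦ by rw [Set.mem_ofPred_eq] at *; rw [mul_assoc, hy])
    (fun {x y} hx ↦ by
      rw [Set.mem_ofPred_eq] at *; rw [mul_assoc, ← (commute_aveIdem y).eq, ← mul_assoc, hx])

theorem mem_aveIdemIdeal [Finite G] [N.Normal] {x : MonoidAlgebra K G} :
    x ∈ aveIdemIdeal K N ↔ x * aveIdem K N = x :=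
  TwoSidedIdeal.mem_mk' ..

theorem IsNKW.mem_of_sq_mem [CharZero K] [Finite G] [N.Normal] (hN : IsNKW K N)
    (x : MonoidAlgebra K G) (hx : x * x ∈ aveIdemIdeal K N) : x ∈ aveIdemIdeal K N := by
  rw [mem_aveIdemIdeal] at *
  set e := aveIdem K N
  have hxe : x * e = e * x := (commute_aveIdem x).eq.symm
  have hee : e * e = e := aveIdem_mul_self
  have hsq : (x - x * e) * (x - x * e) = 0 := by
    have : x * e * (x * e) = x * x := by
      rw [mul_assoc, ← mul_assoc e, ← hxe, mul_assoc x, hee, ← mul_assoc, hx]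
    rw [sub_mul, mul_sub, mul_sub, this, mul_assoc x e x, ← hxe, ← mul_assoc, hx]
    abel
  have := hN _ ⟨2, by rw [sq, hsq]⟩
  rw [sub_mul, mul_assoc, hee, sub_self] at this
  exact (sub_eq_zero.mp this.symm).symm

theorem coeff_mul_of_mem_aveIdemIdeal [Finite G] [N.Normal] {x : MonoidAlgebra K G}
    (hx : x ∈ aveIdemIdeal K N) (g : G) {z : G} (hz : z ∈ N) : x.coeff (g * z) = x.coeff g := by
  rw [mem_aveIdemIdeal] at hx
  have : x * MonoidAlgebra.of K G z = x := by
    rw [← hx, mul_assoc, aveIdem_mul_of ⟨z, hz⟩]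
  nth_rewrite 1 [← this]
  simp

theorem IsNKW.sq_eq_of_conj_ne [Finite G] [N.Normal] (hN : IsNKW ℝ N) {g h : G}
    (h1 : h⁻¹ * g * h ≠ g) (h2 : h⁻¹ * g * h ≠ g⁻¹) {z : G} (hz : z ∈ N) (hz1 : z ≠ 1) :
    g ^ 2 = z := by
  classical
  rw [mul_assoc, ne_eq, inv_mul_eq_iff_eq_mul] at h1 h2
  have key : ∀ z ∈ N, z ≠ 1 → g * h * z = g⁻¹ * h := by
    intro z hz hz1
    let u : (MonoidAlgebra ℝ G)ˣ := (toUnits g).map (MonoidAlgebra.of ℝ G)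
    have hu : (u : MonoidAlgebra ℝ G) = .single g 1 := rfl
    have hu' : ((u⁻¹ : (MonoidAlgebra ℝ G)ˣ) : MonoidAlgebra ℝ G) = .single g⁻¹ 1 := rfl
    have hun : u ^ orderOf g = 1 := by
      rw [← map_pow, ← map_pow, pow_orderOf_eq_one, map_one, map_one]
    have hmem := TwoSidedIdeal.add_inv_commutator_mem hN.mem_of_sq_mem (orderOf_pos g) hun
      (.single h 1)
    have := coeff_mul_of_mem_aveIdemIdeal hmem (g * h) hz
    simp only [hu, hu', add_mul, mul_add, MonoidAlgebra.single_mul_single,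
      MonoidAlgebra.coeff_sub, MonoidAlgebra.coeff_add, MonoidAlgebra.coeff_single,
      Finsupp.sub_apply, Finsupp.add_apply, Finsupp.single_apply, left_eq_mul, hz1,
      Ne.symm h1, Ne.symm h2, mul_one, if_true, if_false] at this
    by_contra hne
    rw [if_neg (Ne.symm hne)] at this
    split_ifs at this <;> norm_num at this
  have h3 := key (h⁻¹ * z⁻¹ * h)
    (by simpa using ‹N.Normal›.conj_mem z⁻¹ (inv_mem hz) h⁻¹)
    (by
      rw [mul_assoc, ne_eq, inv_mul_eq_iff_eq_mul, mul_one, mul_eq_right]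
      exact inv_ne_one.mpr hz1)
  rw [← mul_assoc, ← mul_assoc, mul_inv_cancel_right, mul_left_inj, mul_inv_eq_iff_eq_mul,
    eq_inv_mul_iff_mul_eq, ← sq] at h3
  exact h3

end AveIdem

theorem isReduced_monoidAlgebra_of_comm {K G : Type*} [Field K] [CharZero K] [Group G] [Finite G]
    (h : ∀ a b : G, a * b = b * a) : IsReduced (MonoidAlgebra K G) := by
  let : CommGroup G := { mul_comm := h }
  have : IsSemisimpleRing (MonoidAlgebra K G) := inferInstance
  infer_instance

theorem stmt13 (G : Type*) [Group G] [Finite G]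
    (hcard : ¬ ∃ k : ℕ, Nat.card G = 2 ^ k)
    (hred : ¬ IsReduced (MonoidAlgebra ℝ G))
    (hex : ∃ N : Subgroup G, N.Normal ∧ N ≠ ⊥ ∧ IsNKW ℝ N) :
    IsGenDicyclic G := by
  obtain ⟨N, hNn, hNbot, hN⟩ := hex
  have hG : ¬ ∀ a b : G, a * b = b * a := fun h ↦ hred (isReduced_monoidAlgebra_of_comm h)
  obtain ⟨z, hz, hz1⟩ := N.bot_or_exists_ne_one.resolve_left hNbot
  obtain ⟨p, hp, hpdvd, hpodd⟩ :=
    (Nat.card G).eq_two_pow_or_exists_odd_prime_and_dvd.resolve_left hcard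
  have : Fact p.Prime := ⟨hp⟩
  obtain ⟨c, hc⟩ := exists_prime_orderOf_dvd_card' p hpdvd
  have hc2 : ∀ k, c ^ 2 ^ k ≠ 1 := fun k h ↦ by
    have h2 := hp.dvd_of_dvd_pow (hc ▸ orderOf_dvd_of_pow_eq_one h)
    rw [(Nat.prime_dvd_prime_iff_eq hp Nat.prime_two).mp h2] at hpodd
    exact absurd hpodd (by decide)
  by_cases hall : ∀ g k : G, k⁻¹ * g * k = g ∨ k⁻¹ * g * k = g⁻¹
  · exact absurd (commute_of_forall_conj_eq_or_inv (hc ▸ hpodd) (by simpa using hc2 0) hall) hG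
  push Not at hall
  obtain ⟨g, k, hg, hg'⟩ := hall
  have hzz : z ^ 2 = 1 := by
    rw [sq, ← eq_inv_iff_mul_eq_one]
    exact (hN.sq_eq_of_conj_ne hg hg' hz hz1).symm.trans <|
      hN.sq_eq_of_conj_ne hg hg' (inv_mem hz) (inv_ne_one.mpr hz1)
  refine IsGenDicyclic.of_conj_eq_or_inv_or_sq_eq (hc2 1) (hc2 2) hz1 hzz (fun x ↦ ?_) hg hg'
  by_contra! hx
  obtain ⟨⟨y, hy, hy'⟩, hxz⟩ := hx
  exact hxz (hN.sq_eq_of_conj_ne hy hy' hz hz1)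
end

section
/- Let G be a generalized dicyclic group, with abelian subgroup A of index 2 and element g ∈ G∖A as in the definition. Then ⟨g²⟩ is a nontrivial normal subgroup of G which is a nonideal-kernel witness over ℝ: every nilpotent element x of ℝ[G] satisfies x·e_{⟨g²⟩} = x. Moreover, ℝ[G] is reduced if and only if the quotient G/⟨g²⟩ is abelian. -/
open scoped BigOperators

/-- In a star ring whose star is proper, a normal nilpotent element vanishes. -/
theorem IsNilpotent.eq_zero_of_isStarNormal {R : Type*} [Ring R] [StarRing R]
    (hproper : ∀ x : R, star x * x = 0 → x = 0) {x : R} (hx : IsNilpotent x)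
    [IsStarNormal x] : x = 0 := by
  have hsa : ∀ (k : ℕ) (p : R), star p = p → p ^ 2 ^ k = 0 → p = 0 := by
    intro k
    induction k with
    | zero => intro p _ h; simpa using h
    | succ k ih =>
      intro p hp h
      refine ih p hp (hproper _ ?_)
      rw [star_pow, hp, ← pow_add, ← two_mul, ← pow_succ', h]
  obtain ⟨n, hn⟩ := hx
  refine hproper x (hsa n _ (by simp) ?_)
  refine pow_eq_zero_of_le n.lt_two_pow_self.le ?_
  rw [Commute.mul_pow (star_comm_self' x), hn, mul_zero]

namespace MonoidAlgebra

variable {G : Type*} [Group G]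

/-- The linear extension of inversion makes a real group algebra a star ring. -/
noncomputable instance instStarRingReal : StarRing (MonoidAlgebra ℝ G) where
  star := mapDomain (·⁻¹)
  star_involutive x := by
    induction x using induction_linear with
    | zero => simp
    | add x y hx hy => rw [mapDomain_add, mapDomain_add, hx, hy]
    | single g r => simp
  star_add x y := mapDomain_add ..
  star_mul x y := by
    change mapDomain _ _ = mapDomain _ _ * mapDomain _ _
    induction x using induction_linear with
    | zero => simp
    | add x x' hx hx' => simp only [mapDomain_add, add_mul, mul_add, hx, hx']
    | single g r =>
      induction y using induction_linear with
      | zero => simp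
      | add y y' hy hy' => simp only [mapDomain_add, add_mul, mul_add, hy, hy']
      | single h s => simp [single_mul_single, mul_comm]

@[simp]
theorem star_single_real (g : G) (r : ℝ) : star (single g r) = single g⁻¹ r := mapDomain_single

theorem coeff_star_real (x : MonoidAlgebra ℝ G) (g : G) :
    (star x).coeff g = x.coeff g⁻¹ := by
  classical
  induction x using induction_linear with
  | zero => simp
  | add x y hx hy => simp [hx, hy]
  | single h r => simp [Finsupp.single_apply, inv_eq_iff_eq_inv]

theorem eq_zero_of_star_mul_self_eq_zero {x : MonoidAlgebra ℝ G} (h : star x * x = 0) :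
    x = 0 := by
  have h1 : ∑ g ∈ x.coeff.support, x.coeff g * x.coeff g = 0 := by
    have := congrArg (fun y ↦ y.coeff 1) h
    simpa [coeff_mul_apply_right, coeff_star_real, Finsupp.sum] using this
  rw [Finset.sum_eq_zero_iff_of_nonneg fun _ _ ↦ mul_self_nonneg _] at h1
  ext g
  by_cases hg : g ∈ x.coeff.support
  · simpa using h1 g hg
  · simpa using hg

theorem eq_zero_of_isNilpotent_of_isStarNormal {x : MonoidAlgebra ℝ G} (hx : IsNilpotent x)
    [IsStarNormal x] : x = 0 :=
  hx.eq_zero_of_isStarNormal fun _ ↦ eq_zero_of_star_mul_self_eq_zero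

/-- If all commutators of `G` lie in `{1, z}` for a central `z` with `z * z = 1`, then every
element `x` with `x * z = x` is central in `ℝ[G]`. -/
theorem commute_of_mul_single_eq {z : G} (hz : ∀ g h : G, g * h = h * g ∨ g * h = h * g * z)
    (hzc : ∀ g : G, Commute z g) (hz2 : z * z = 1)
    {x : MonoidAlgebra ℝ G} (hx : x * single z 1 = x) (y : MonoidAlgebra ℝ G) :
    Commute x y := by
  have hc (w : MonoidAlgebra ℝ G) : Commute (single z 1) w :=
    single_commute hzc (fun _ ↦ .one_left _) w
  have key : ∀ u v : MonoidAlgebra ℝ G,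
      (u * v) * (1 + single z 1) = (v * u) * (1 + single z 1) := by
    intro u v
    induction u using induction_linear with
    | zero => simp
    | add u u' hu hu' => rw [add_mul, add_mul, hu, hu', ← add_mul, ← mul_add]
    | single g r =>
      induction v using induction_linear with
      | zero => simp
      | add v v' hv hv' => rw [mul_add (single g r), add_mul (_ * v), hv, hv', ← add_mul, ← add_mul]
      | single h s =>
        rcases hz g h with e | e
        · simp [single_mul_single, e, mul_comm]
        · simp [single_mul_single, mul_add, e, mul_comm r s, mul_assoc _ z z, hz2, add_comm]
  have h2 := key x y
  rw [mul_add, mul_add, mul_one, mul_one, mul_assoc, ← (hc y).eq, ← mul_assoc, hx,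
    mul_assoc y, hx, ← two_mul, ← two_mul] at h2
  have h3 := congrArg (fun w ↦ (2⁻¹ : ℝ) • w) h2
  have h4 (w : MonoidAlgebra ℝ G) : (2⁻¹ : ℝ) • (2 * w) = w := by
    rw [two_mul, ← two_smul ℝ w, smul_smul]; norm_num
  rwa [h4, h4] at h3

end MonoidAlgebra

open MonoidAlgebra

/-- If every element of `N` fixes `x` by right translation, then so does the average over `N`. -/
theorem mul_aveIdem_of_forall_mul_of {K G : Type*} [Field K] [CharZero K] [Group G] [Finite G]
    {N : Subgroup G} {x : MonoidAlgebra K G} (h : ∀ n ∈ N, x * of K G n = x) :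
    x * aveIdem K N = x := by
  have := Fintype.ofFinite N
  rw [aveIdem, mul_smul_comm, finsum_eq_sum_of_fintype, Finset.mul_sum,
    Finset.sum_congr rfl fun (n : N) _ ↦ h n n.2, Finset.sum_const, Finset.card_univ,
    ← Nat.card_eq_fintype_card, ← Nat.cast_smul_eq_nsmul K, smul_smul,
    inv_mul_cancel₀ (by exact_mod_cast Nat.card_pos.ne'), one_smul]

section GeneralizedDicyclic

variable {G : Type*} [Group G] {A : Subgroup G} {z : G}

/-- If the elements outside an abelian subgroup `A` invert `A` and all square to the central
involution `z`, then `z` fixes every nilpotent element of `ℝ[G]`. -/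
theorem mul_single_eq_self_of_isNilpotent (hA : ∀ a ∈ A, ∀ b ∈ A, a * b = b * a)
    (hinv : ∀ h ∉ A, ∀ a ∈ A, h * a * h⁻¹ = a⁻¹) (hsq : ∀ h ∉ A, h * h = z)
    (hz2 : z * z = 1) (hzc : ∀ h : G, Commute z h)
    {x : MonoidAlgebra ℝ G} (hx : IsNilpotent x) : x * single z 1 = x := by
  set d : MonoidAlgebra ℝ G := 1 - single z 1 with hd
  have hdc (w : MonoidAlgebra ℝ G) : Commute d w :=
    (Commute.one_left w).sub_left (single_commute hzc (fun _ ↦ .one_left _) w)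
  have hds : star d = d := by
    simp [hd, inv_eq_of_mul_eq_one_left hz2]
  have hcentral : ∀ x w : MonoidAlgebra ℝ G, Commute ((x + star x) * d) w := by
    intro x w
    induction x using induction_linear with
    | zero => simp
    | add x y hx hy =>
      have e : (x + y + star (x + y)) * d = (x + star x) * d + (y + star y) * d := by
        rw [star_add]; noncomm_ring
      rw [e]
      exact hx.add_left hy
    | single g r =>
      by_cases hg : g ∈ A
      · refine .mul_left ?_ (hdc w)
        induction w using induction_linear with
        | zero => simp
        | add u v hu hv => exact hu.add_right hv
        | single h s =>
          rw [star_single_real]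
          by_cases hh : h ∈ A
          · exact (single_commute_single (hA g hg h hh) (mul_comm r s)).add_left
              (single_commute_single (hA _ (A.inv_mem hg) h hh) (mul_comm r s))
          · have e1 : h * g = g⁻¹ * h := by rw [← hinv h hh g hg]; group
            have e2 : h * g⁻¹ = g * h := by
              rw [← mul_inv_eq_iff_eq_mul, hinv h hh _ (A.inv_mem hg), inv_inv]
            simp only [Commute, SemiconjBy, add_mul, mul_add, single_mul_single, e1, e2,
              mul_comm r s]
            rw [add_comm]
      · have hgi : g⁻¹ = g * z := by
          rw [inv_eq_iff_mul_eq_one, ← mul_assoc, hsq g hg, hz2]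
        have : (single g r + star (single g r)) * d = 0 := by
          simp [hd, hgi, mul_sub, add_mul, single_mul_single, one_def, mul_assoc, hz2, add_comm]
        rw [this]; exact .zero_left _
  have hstar : star (x * d) = (x + star x) * d - x * d := by
    rw [star_mul, hds, (hdc _).eq, add_mul, add_sub_cancel_left]
  have : IsStarNormal (x * d) := ⟨by
    rw [hstar]; exact (hcentral x _).sub_left (.refl _)⟩
  have h0 : x * d = 0 :=
    eq_zero_of_isNilpotent_of_isStarNormal ((hdc x).symm.isNilpotent_mul_right hx)
  rw [hd, mul_sub, mul_one, sub_eq_zero] at h0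
  exact h0.symm

theorem isReduced_of_mul_single_eq (hz : ∀ g h : G, g * h = h * g ∨ g * h = h * g * z)
    (hzc : ∀ g : G, Commute z g) (hz2 : z * z = 1)
    (hnil : ∀ x : MonoidAlgebra ℝ G, IsNilpotent x → x * single z 1 = x) :
    IsReduced (MonoidAlgebra ℝ G) where
  eq_zero x hx := by
    have : IsStarNormal x := ⟨(commute_of_mul_single_eq hz hzc hz2 (hnil x hx) _).symm⟩
    exact eq_zero_of_isNilpotent_of_isStarNormal hx

/-- If `ℝ[G]` is reduced, then every cyclic subgroup generated by an element `g` with `g ^ 4 = 1`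
is normal. -/
theorem exists_mul_eq_mul_pow_of_isReduced_of_pow_four_eq_one [IsReduced (MonoidAlgebra ℝ G)]
    {g : G} (hg : g ^ 4 = 1) (a : G) : ∃ k : ℕ, g * a = a * g ^ k := by
  set N : MonoidAlgebra ℝ G := ∑ k ∈ Finset.range 4, single (g ^ k) 1 with hN
  have hgeom : N * (1 - single g 1) = 0 := by
    have : N = ∑ k ∈ Finset.range 4, single g 1 ^ k := by simp [hN, single_pow]
    rw [this, ← neg_sub, mul_neg, geom_sum_mul, single_pow, hg, one_pow, ← one_def, sub_self,
      neg_zero]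
  have h0 : (1 - single g 1) * single a 1 * N = 0 := by
    refine IsReduced.eq_zero _ ⟨2, ?_⟩
    calc _ = (1 - single g 1) * single a 1 * (N * (1 - single g 1)) * single a 1 * N := by
          noncomm_ring
      _ = 0 := by rw [hgeom]; simp
  by_contra! hne
  have h1 := congrArg (fun y ↦ y.coeff (g * a)) h0
  classical
  have h2 : (∑ k ∈ Finset.range 4, (single (a * g ^ k) (1 : ℝ)).coeff (g * a)) = 0 :=
    Finset.sum_eq_zero fun k _ ↦ by simp [(hne k).symm]
  have h3 : (1 : ℝ) ≤ ∑ k ∈ Finset.range 4, (single (g * a * g ^ k) (1 : ℝ)).coeff (g * a) := by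
    refine le_trans (by simp) (Finset.single_le_sum (f := fun k ↦
      (single (g * a * g ^ k) (1 : ℝ)).coeff (g * a)) (fun k _ ↦ ?_)
      (Finset.mem_range.2 four_pos))
    simp only [coeff_single, Finsupp.single_apply]
    split_ifs <;> simp
  simp [hN, sub_mul, Finset.mul_sum, single_mul_single, coeff_sum]
    at h1 h2 h3
  linarith

end GeneralizedDicyclic

/-- In the last conjunct, "`G ⧸ ⟨g²⟩` is abelian" is expressed by the equivalent
condition that all commutators of `G` lie in `⟨g²⟩`. -/
theorem stmt14 (G : Type*) [Group G] [Finite G]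
    (hnab : ¬ ∀ a b : G, a * b = b * a)
    (A : Subgroup G) (g : G)
    (hA : ∀ a b : A, a * b = b * a) (hidx : A.index = 2)
    (hg : g ∉ A) (hg2 : g ^ 2 ≠ 1) (hinv : ∀ a ∈ A, g⁻¹ * a * g = a⁻¹) :
    (Subgroup.zpowers (g ^ 2)).Normal ∧ Subgroup.zpowers (g ^ 2) ≠ ⊥ ∧
    IsNKW ℝ (Subgroup.zpowers (g ^ 2)) ∧
    (IsReduced (MonoidAlgebra ℝ G) ↔
      ∀ x y : G, x * y * x⁻¹ * y⁻¹ ∈ Subgroup.zpowers (g ^ 2)) := by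
  have hA' : ∀ a ∈ A, ∀ b ∈ A, a * b = b * a := fun a ha b hb ↦
    congrArg Subtype.val (hA ⟨a, ha⟩ ⟨b, hb⟩)
  set z := g ^ 2 with hz
  have hzA : z ∈ A := Subgroup.sq_mem_of_index_two hidx g
  have hz2 : z * z = 1 := by
    rw [← inv_eq_iff_mul_eq_one, ← hinv z hzA, hz]; group
  have hginv : ∀ a ∈ A, g * a * g⁻¹ = a⁻¹ := fun a ha ↦ by
    calc g * a * g⁻¹ = g * (g⁻¹ * a⁻¹ * g) * g⁻¹ := by rw [hinv _ (A.inv_mem ha), inv_inv]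
      _ = a⁻¹ := by group
  have hdecomp : ∀ h ∉ A, ∃ a ∈ A, h = a * g := fun h hh ↦ by
    refine ⟨h * g⁻¹, ?_, by group⟩
    rw [Subgroup.mul_mem_iff_of_index_two hidx, inv_mem_iff]
    exact iff_of_false hh hg
  have hinv' : ∀ h ∉ A, ∀ a ∈ A, h * a * h⁻¹ = a⁻¹ := by
    intro h hh a ha
    obtain ⟨b, hb, rfl⟩ := hdecomp h hh
    calc b * g * a * (b * g)⁻¹ = b * (g * a * g⁻¹) * b⁻¹ := by group
      _ = a⁻¹ := by rw [hginv a ha, hA' b hb _ (A.inv_mem ha)]; group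
  have hsq : ∀ h ∉ A, h * h = z := by
    intro h hh
    obtain ⟨b, hb, rfl⟩ := hdecomp h hh
    calc b * g * (b * g) = b * (g * b * g⁻¹) * z := by rw [hz]; group
      _ = z := by rw [hginv b hb]; group
  have hzc : ∀ h : G, Commute z h := by
    intro h
    by_cases hh : h ∈ A
    · exact hA' z hzA h hh
    · rw [← hsq h hh]; exact (Commute.refl h).mul_left (.refl h)
  have hmem : ∀ h, h ∈ Subgroup.zpowers z ↔ h = 1 ∨ h = z := by
    intro h
    constructor
    · rintro ⟨k, rfl⟩
      have hzz : z ^ (2 : ℤ) = 1 := by rw [zpow_two, hz2]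
      rcases Int.even_or_odd' k with ⟨m, rfl | rfl⟩
      · left; simp [zpow_mul, hzz]
      · right; simp [zpow_add, zpow_mul, hzz]
    · rintro (rfl | rfl)
      · exact one_mem _
      · exact Subgroup.mem_zpowers _
  have hnil : ∀ x : MonoidAlgebra ℝ G, IsNilpotent x → x * single z 1 = x := fun x hx ↦
    mul_single_eq_self_of_isNilpotent hA' hinv' hsq hz2 hzc hx
  refine ⟨⟨fun n hn h ↦ ?_⟩, by simpa using hg2, fun x hx ↦ ?_, fun hred ↦ ?_, fun hcomm ↦ ?_⟩
  · rcases (hmem n).1 hn with rfl | rfl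
    · simp
    · rw [← (hzc h).eq, mul_inv_cancel_right]; exact hn
  · refine mul_aveIdem_of_forall_mul_of fun n hn ↦ ?_
    rcases (hmem n).1 hn with rfl | rfl
    · rw [map_one, mul_one]
    · exact hnil x hx
  · have hasq : ∀ a ∈ A, a * a ∈ Subgroup.zpowers z := by
      intro a ha
      obtain ⟨k, hk⟩ := exists_mul_eq_mul_pow_of_isReduced_of_pow_four_eq_one
        (show g ^ 4 = 1 by rw [← hz2, hz]; group) a
      have e : a * a = g * (g ^ k)⁻¹ := by
        rw [eq_mul_inv_iff_mul_eq]
        calc a * a * g ^ k = a * (g * a * g⁻¹) * g := by rw [mul_assoc, ← hk]; group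
          _ = g := by rw [hginv a ha]; group
      rcases Nat.even_or_odd' k with ⟨j, rfl | rfl⟩
      · refine absurd ?_ hg
        rw [eq_mul_inv_iff_mul_eq, pow_mul] at e
        rw [← e]
        exact A.mul_mem (A.mul_mem ha ha) (A.pow_mem hzA j)
      · rw [e, pow_succ, mul_inv_rev, mul_inv_cancel_left, pow_mul]
        exact inv_mem (pow_mem (Subgroup.mem_zpowers z) j)
    have hcomm : ∀ x ∈ A, ∀ y ∉ A, x * y * x⁻¹ * y⁻¹ ∈ Subgroup.zpowers z := by
      intro x hx y hy
      have : x * y * x⁻¹ * y⁻¹ = x * x := by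
        have h := hinv' y hy _ (A.inv_mem hx)
        rw [inv_inv] at h
        rw [mul_assoc x y, mul_assoc x, h]
      rw [this]; exact hasq x hx
    intro x y
    by_cases hx : x ∈ A
    · by_cases hy : y ∈ A
      · rw [hA' x hx y hy]; simp
      · exact hcomm x hx y hy
    · by_cases hy : y ∈ A
      · have := inv_mem (hcomm y hy x hx)
        convert this using 1; group
      · have hxy : x * y ∈ A := by
          rw [Subgroup.mul_mem_iff_of_index_two hidx]; exact iff_of_false hx hy
        have := hcomm _ hxy x⁻¹ (by simpa using hx)
        convert this using 1; group
  · refine isReduced_of_mul_single_eq (fun a b ↦ ?_) hzc hz2 hnil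
    rcases (hmem _).1 (hcomm a b) with h | h
    · left; rw [← mul_inv_eq_one, ← h]; group
    · right; rw [← (hzc _).eq, ← h]; group
end

section
/- Let G = C₄ × Q₈ × (C₂)^r for some r ≥ 0, let u be a generator of the C₄ factor, let x be an element of order 4 of the Q₈ factor, and set z := (u², x², 1) ∈ G. Then z ≠ 1, the subgroup ⟨z⟩ equals the intersection of all nonnormal subgroups of G, and ⟨z⟩ is a nonideal-kernel witness over ℝ: every nilpotent element w of ℝ[G] satisfies w·e_{⟨z⟩} = w. -/
open scoped BigOperators

namespace MonoidAlgebra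

variable {G : Type*} [Group G]

/-- The standard involution of the real group algebra, extending inversion on `G` linearly. -/
noncomputable def invol (w : MonoidAlgebra ℝ G) : MonoidAlgebra ℝ G :=
  mapDomain (fun g : G => g⁻¹) w

@[simp]
lemma invol_zero : invol (0 : MonoidAlgebra ℝ G) = 0 := mapDomain_zero _

lemma invol_add (v w : MonoidAlgebra ℝ G) : invol (v + w) = invol v + invol w :=
  mapDomain_add _ _ _

lemma invol_neg (w : MonoidAlgebra ℝ G) : invol (-w) = -invol w := by
  rw [eq_neg_iff_add_eq_zero, ← invol_add, neg_add_cancel, invol_zero]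

lemma invol_sub (v w : MonoidAlgebra ℝ G) : invol (v - w) = invol v - invol w := by
  rw [sub_eq_add_neg, invol_add, invol_neg, ← sub_eq_add_neg]

@[simp]
lemma invol_single (g : G) (r : ℝ) : invol (single g r) = single g⁻¹ r := mapDomain_single

@[simp]
lemma invol_one : invol (1 : MonoidAlgebra ℝ G) = 1 := by
  simp [one_def]

lemma invol_invol (w : MonoidAlgebra ℝ G) : invol (invol w) = w := by
  induction w using induction_linear with
  | zero => simp
  | add x y hx hy => simp [invol_add, hx, hy]
  | single g r => simp

lemma invol_mul (v w : MonoidAlgebra ℝ G) : invol (v * w) = invol w * invol v := by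
  induction v using induction_linear with
  | zero => simp
  | add x y hx hy => simp [invol_add, add_mul, mul_add, hx, hy]
  | single g r =>
    induction w using induction_linear with
    | zero => simp
    | add x y hx hy => simp [invol_add, add_mul, mul_add, hx, hy]
    | single h s => simp [single_mul_single, mul_comm]

lemma coeff_invol_inv (w : MonoidAlgebra ℝ G) (g : G) : (invol w).coeff g⁻¹ = w.coeff g := by
  rw [invol, coeff_mapDomain]
  exact Finsupp.mapDomain_apply inv_injective w.coeff g

lemma eq_zero_of_mul_invol_eq_zero {w : MonoidAlgebra ℝ G} (h : w * invol w = 0) : w = 0 := by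
  have h1 : w.coeff.sum (fun g r => r * (invol w).coeff (g⁻¹ * 1)) = 0 := by
    rw [← coeff_mul_apply_left, h]
    rfl
  simp only [mul_one, coeff_invol_inv, Finsupp.sum] at h1
  rw [Finset.sum_eq_zero_iff_of_nonneg fun g _ => mul_self_nonneg _] at h1
  ext g
  by_cases hg : g ∈ w.coeff.support
  · simpa using h1 g hg
  · simpa using hg

lemma eq_zero_of_isNilpotent_of_invol_eq {b : MonoidAlgebra ℝ G} (hb : IsNilpotent b)
    (hs : invol b = b) : b = 0 := by
  obtain ⟨n, hn⟩ := hb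
  have hpow (k : ℕ) : invol (b ^ k) = b ^ k := by
    induction k with
    | zero => simp
    | succ k ih => rw [pow_succ, invol_mul, ih, hs, ← pow_succ', pow_succ]
  have key (k : ℕ) (hk : b ^ 2 ^ k = 0) : b = 0 := by
    induction k with
    | zero => simpa using hk
    | succ k ih =>
      refine ih (eq_zero_of_mul_invol_eq_zero ?_)
      rw [hpow, ← pow_add, ← two_mul, ← pow_succ', hk]
  exact key n (pow_eq_zero_of_le n.lt_two_pow_self.le hn)

/-- A nilpotent element of the real group algebra which is normal for the involution vanishes. -/
lemma eq_zero_of_isNilpotent_of_commute_invol {y : MonoidAlgebra ℝ G} (hy : IsNilpotent y)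
    (hc : Commute y (invol y)) : y = 0 :=
  eq_zero_of_mul_invol_eq_zero <|
    eq_zero_of_isNilpotent_of_invol_eq (hc.isNilpotent_mul_right hy) <| by
      rw [invol_mul, invol_invol]

lemma commute_single_of_mem_center {z : G} (hz : ∀ g, g * z = z * g) (w : MonoidAlgebra ℝ G) :
    w * single z 1 = single z 1 * w := by
  induction w using induction_linear with
  | zero => simp
  | add x y hx hy => rw [add_mul, mul_add, hx, hy]
  | single g r => simp [single_mul_single, hz]

variable {z : G}

lemma polarized_normality (hz2 : z * z = 1)
    (h3 : ∀ g h : G, g * h⁻¹ = h⁻¹ * g ∨ g * h⁻¹ = g⁻¹ * h ∨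
      (h * g⁻¹ = g * h⁻¹ * z ∧ g⁻¹ * h = h⁻¹ * g * z))
    (v w : MonoidAlgebra ℝ G) :
    (v * invol w + w * invol v - invol w * v - invol v * w) * (1 - single z 1) = 0 := by
  induction v using induction_linear with
  | zero => simp
  | add x y hx hy =>
    rw [← add_zero (0 : MonoidAlgebra ℝ G)]
    nth_rewrite 1 [← hx]
    rw [← hy, invol_add]
    noncomm_ring
  | single g r =>
    induction w using induction_linear with
    | zero => simp
    | add x y hx hy =>
      rw [← add_zero (0 : MonoidAlgebra ℝ G)]
      nth_rewrite 1 [← hx]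
      rw [← hy, invol_add]
      noncomm_ring
    | single h s =>
      simp only [invol_single, single_mul_single, mul_comm s r]
      rcases h3 g h with e | e | ⟨e1, e2⟩
      · have e' : h * g⁻¹ = g⁻¹ * h := by simpa using congrArg (·⁻¹) e
        rw [e, e']
        simp
      · have e' : h * g⁻¹ = h⁻¹ * g := by simpa using congrArg (·⁻¹) e
        rw [e, e']
        simp
      · rw [e1, e2]
        simp only [mul_sub, add_mul, sub_mul, mul_one, single_mul_single, mul_assoc, hz2]
        abel

lemma mul_one_sub_eq_zero_of_isNilpotent (hz : ∀ g, g * z = z * g) (hz2 : z * z = 1)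
    (h3 : ∀ g h : G, g * h⁻¹ = h⁻¹ * g ∨ g * h⁻¹ = g⁻¹ * h ∨
      (h * g⁻¹ = g * h⁻¹ * z ∧ g⁻¹ * h = h⁻¹ * g * z))
    {w : MonoidAlgebra ℝ G} (hw : IsNilpotent w) : w * (1 - single z 1) = 0 := by
  set e : MonoidAlgebra ℝ G := 1 - single z 1 with he
  have hce (v : MonoidAlgebra ℝ G) : v * e = e * v := by
    rw [he, mul_sub, sub_mul, commute_single_of_mem_center hz, mul_one, one_mul]
  have hie : invol e = e := by
    rw [he, invol_sub, invol_one, invol_single, inv_eq_of_mul_eq_one_left hz2]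
  have hN : w * invol w * e = invol w * w * e := by
    have h2 := polarized_normality hz2 h3 w w
    rw [← he] at h2
    have h4 : (2 : ℝ) • (w * invol w * e - invol w * w * e) = 0 := by
      rw [two_smul, ← h2]
      noncomm_ring
    exact sub_eq_zero.mp ((smul_eq_zero.mp h4).resolve_left two_ne_zero)
  refine eq_zero_of_isNilpotent_of_commute_invol
    (Commute.isNilpotent_mul_right (hce w) hw) ?_
  change w * e * invol (w * e) = invol (w * e) * (w * e)
  rw [invol_mul, hie]
  calc w * e * (e * invol w) = w * invol w * e * e := by
        rw [← hce (invol w), mul_assoc w e, ← mul_assoc e (invol w), ← hce (invol w)]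
        simp only [mul_assoc]
    _ = invol w * w * e * e := by rw [hN]
    _ = e * invol w * (w * e) := by rw [← hce (invol w), mul_assoc (invol w) e, ← mul_assoc e w,
          ← hce w, mul_assoc, mul_assoc, mul_assoc]

end MonoidAlgebra

lemma coe_zpowers_of_mul_self_eq_one {G : Type*} [Group G] {z : G} (hz2 : z * z = 1) :
    (Subgroup.zpowers z : Set G) = {1, z} := by
  ext g
  simp only [SetLike.mem_coe, Subgroup.mem_zpowers_iff, Set.mem_insert_iff, Set.mem_singleton_iff]
  constructor
  · rintro ⟨k, rfl⟩
    rcases Int.even_or_odd' k with ⟨n, rfl | rfl⟩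
    · left
      rw [zpow_mul, zpow_two, hz2, one_zpow]
    · right
      rw [zpow_add, zpow_mul, zpow_two, hz2, one_zpow, one_mul, zpow_one]
  · rintro (rfl | rfl)
    · exact ⟨0, zpow_zero z⟩
    · exact ⟨1, zpow_one g⟩

lemma aveIdem_zpowers_of_mul_self_eq_one {G : Type*} [Group G] {z : G} (hz1 : z ≠ 1)
    (hz2 : z * z = 1) :
    aveIdem ℝ (Subgroup.zpowers z) =
      (2 : ℝ)⁻¹ • (1 + MonoidAlgebra.single z 1 : MonoidAlgebra ℝ G) := by
  have hcard : Nat.card (Subgroup.zpowers z) = 2 := by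
    change Nat.card (Subgroup.zpowers z : Set G) = 2
    rw [coe_zpowers_of_mul_self_eq_one hz2, Nat.card_coe_set_eq, Set.ncard_pair hz1.symm]
  have hsum : ∑ᶠ n : Subgroup.zpowers z, MonoidAlgebra.of ℝ G (n : G) =
      1 + MonoidAlgebra.single z 1 := by
    have := finsum_mem_pair (f := fun g => MonoidAlgebra.of ℝ G g) hz1.symm
    rw [← coe_zpowers_of_mul_self_eq_one hz2, ← finsum_set_coe_eq_finsum_mem] at this
    simpa [MonoidAlgebra.of_apply, MonoidAlgebra.one_def] using this
  rw [aveIdem, hcard, hsum]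
  norm_num

lemma isNKW_zpowers {G : Type*} [Group G] {z : G} (hz1 : z ≠ 1) (hz : ∀ g, g * z = z * g)
    (hz2 : z * z = 1)
    (h3 : ∀ g h : G, g * h⁻¹ = h⁻¹ * g ∨ g * h⁻¹ = g⁻¹ * h ∨
      (h * g⁻¹ = g * h⁻¹ * z ∧ g⁻¹ * h = h⁻¹ * g * z)) :
    IsNKW ℝ (Subgroup.zpowers z) := by
  intro w hw
  have h := MonoidAlgebra.mul_one_sub_eq_zero_of_isNilpotent hz hz2 h3 hw
  rw [mul_sub, mul_one, sub_eq_zero] at h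
  rw [aveIdem_zpowers_of_mul_self_eq_one hz1 hz2, mul_smul_comm, mul_add, mul_one, ← h,
    ← two_smul ℝ w, smul_smul]
  norm_num

namespace QuaternionGroup

lemma sq_eq_of_orderOf_eq_four {x : QuaternionGroup 2} (hx : orderOf x = 4) : x ^ 2 = a 2 := by
  have h1 : x ^ 2 ≠ 1 := pow_ne_one_of_lt_orderOf two_ne_zero (by omega)
  revert h1
  clear hx
  revert x
  decide

lemma commute_or_conj_two : ∀ p q : QuaternionGroup 2,
    p * q⁻¹ = q⁻¹ * p ∨ (p * q⁻¹ = p⁻¹ * q ∧ q * p⁻¹ = p * q⁻¹ * a 2 ∧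
      p⁻¹ * q = q⁻¹ * p * a 2) := by
  decide

lemma commute_or_sq_two : ∀ p q : QuaternionGroup 2,
    q * p * q⁻¹ = p ∨ (p * p = a 2 ∧ q * p * q⁻¹ = p * a 2) := by
  decide

end QuaternionGroup

lemma sq_eq_of_zpowers_eq_top {u : Multiplicative (ZMod 4)} (hu : Subgroup.zpowers u = ⊤) :
    u ^ 2 = Multiplicative.ofAdd 2 := by
  have h1 : u ^ 2 ≠ 1 := by
    intro h
    have h2 : orderOf u = 4 := by
      rw [← Nat.card_zpowers, hu, Subgroup.card_top]
      simp
    have := orderOf_dvd_of_pow_eq_one h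
    rw [h2] at this
    omega
  revert h1
  clear hu
  revert u
  decide

lemma zmod_four_mul_inv : ∀ s t : Multiplicative (ZMod 4),
    s * t⁻¹ = s⁻¹ * t ∨ (t * s⁻¹ = s * t⁻¹ * Multiplicative.ofAdd 2) := by
  decide

lemma zmod_four_mul_self : ∀ s : Multiplicative (ZMod 4),
    s * s = 1 ∨ s * s = Multiplicative.ofAdd 2 := by
  decide

lemma zmod_two_inv (v : Multiplicative (ZMod 2)) : v⁻¹ = v := by
  revert v
  decide

namespace HamiltonianTimesC4

/-- The group `C₄ × Q₈ × C₂^r`. -/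
abbrev Grp (r : ℕ) : Type :=
  Multiplicative (ZMod 4) × QuaternionGroup 2 × (Fin r → Multiplicative (ZMod 2))

/-- The product of the involution of `C₄` with that of `Q₈`. -/
abbrev zElt (r : ℕ) : Grp r := (Multiplicative.ofAdd 2, QuaternionGroup.a 2, 1)

lemma pi_inv {r : ℕ} (v : Fin r → Multiplicative (ZMod 2)) : v⁻¹ = v :=
  funext fun i => zmod_two_inv (v i)

lemma pi_mul_self {r : ℕ} (v : Fin r → Multiplicative (ZMod 2)) : v * v = 1 := by
  nth_rewrite 1 [← pi_inv v]
  exact inv_mul_cancel v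

variable {r : ℕ}

lemma zElt_ne_one : zElt r ≠ 1 := fun h =>
  absurd (congrArg Prod.fst h) (by decide : (Multiplicative.ofAdd (2 : ZMod 4)) ≠ 1)

lemma zElt_mul_self : zElt r * zElt r = 1 :=
  Prod.ext (by decide : Multiplicative.ofAdd (2 : ZMod 4) * Multiplicative.ofAdd 2 = 1)
    (Prod.ext (by decide : (QuaternionGroup.a 2 : QuaternionGroup 2) * QuaternionGroup.a 2 = 1)
      (one_mul 1))

lemma mul_zElt (g : Grp r) : g * zElt r = zElt r * g :=
  Prod.ext (mul_comm _ _) (Prod.ext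
    ((by decide : ∀ q : QuaternionGroup 2, q * QuaternionGroup.a 2 = QuaternionGroup.a 2 * q) _)
    (mul_comm _ _))

lemma mul_inv_trichotomy (g h : Grp r) :
    g * h⁻¹ = h⁻¹ * g ∨ g * h⁻¹ = g⁻¹ * h ∨
      (h * g⁻¹ = g * h⁻¹ * zElt r ∧ g⁻¹ * h = h⁻¹ * g * zElt r) := by
  obtain ⟨s, p, v⟩ := g
  obtain ⟨t, q, w⟩ := h
  rcases QuaternionGroup.commute_or_conj_two p q with e | ⟨e1, e2, e3⟩
  · left
    exact Prod.ext (mul_comm _ _) (Prod.ext e (mul_comm _ _))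
  · right
    rcases zmod_four_mul_inv s t with f | f
    · left
      refine Prod.ext f (Prod.ext e1 ?_)
      change v * w⁻¹ = v⁻¹ * w
      rw [pi_inv, pi_inv]
    · right
      refine ⟨Prod.ext f (Prod.ext e2 ?_), Prod.ext ?_ (Prod.ext e3 ?_)⟩
      · change w * v⁻¹ = v * w⁻¹ * 1
        rw [pi_inv, pi_inv, mul_one, mul_comm]
      · change s⁻¹ * t = t⁻¹ * s * Multiplicative.ofAdd 2
        rw [mul_comm s⁻¹, f, mul_comm s]
      · change v⁻¹ * w = w⁻¹ * v * 1
        rw [pi_inv, pi_inv, mul_one, mul_comm]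

lemma zElt_mem_of_not_normal {U : Subgroup (Grp r)} (hU : ¬ U.Normal) : zElt r ∈ U := by
  by_contra hz
  refine hU ⟨fun g hg h => ?_⟩
  obtain ⟨s, p, v⟩ := g
  obtain ⟨t, q, w⟩ := h
  have hsq := U.mul_mem hg hg
  rcases QuaternionGroup.commute_or_sq_two p q with e | ⟨e1, e2⟩
  · convert hg using 1
    exact Prod.ext (mul_inv_cancel_comm _ _) (Prod.ext e (mul_inv_cancel_comm _ _))
  · rcases zmod_four_mul_self s with f | f
    · convert U.mul_mem hg hsq using 1
      refine Prod.ext ?_ (Prod.ext ?_ ?_)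
      · change t * s * t⁻¹ = s * (s * s)
        rw [f, mul_one, mul_inv_cancel_comm]
      · change q * p * q⁻¹ = p * (p * p)
        rw [e1, e2]
      · change w * v * w⁻¹ = v * (v * v)
        rw [pi_mul_self, mul_one, mul_inv_cancel_comm]
    · refine absurd ?_ hz
      convert hsq using 1
      exact Prod.ext f.symm (Prod.ext e1.symm (pi_mul_self v).symm)

lemma mem_zpowers_iff_of_sq {y g : Grp r} (hy : y * y = zElt r) :
    g ∈ Subgroup.zpowers y ↔ g = 1 ∨ g = y ∨ g = zElt r ∨ g = zElt r * y := by
  constructor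
  · intro hg
    obtain ⟨k, rfl⟩ := Subgroup.mem_zpowers_iff.mp hg
    have hmem (j : ℤ) : (zElt r) ^ j = 1 ∨ (zElt r) ^ j = zElt r := by
      have : (zElt r) ^ j ∈ (Subgroup.zpowers (zElt r) : Set (Grp r)) :=
        Subgroup.zpow_mem_zpowers _ _
      rwa [coe_zpowers_of_mul_self_eq_one zElt_mul_self] at this
    rcases Int.even_or_odd' k with ⟨n, rfl | rfl⟩
    · rw [zpow_mul, zpow_two, hy]
      rcases hmem n with h | h <;> simp [h]
    · rw [zpow_add, zpow_mul, zpow_two, hy, zpow_one]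
      rcases hmem n with h | h <;> simp [h]
  · have h1 := Subgroup.mem_zpowers y
    have h2 : zElt r ∈ Subgroup.zpowers y := hy ▸ mul_mem h1 h1
    rintro (rfl | rfl | rfl | rfl)
    exacts [one_mem _, h1, h2, mul_mem h2 h1]

/-- The element `(1, q, 1)` of `C₄ × Q₈ × C₂^r`, with `1 : ℤ/4` the generator of `C₄`. -/
abbrev diagElt (r : ℕ) (q : QuaternionGroup 2) : Grp r := (Multiplicative.ofAdd 1, q, 1)

lemma diagElt_mul_self {q : QuaternionGroup 2} (hq : q * q = QuaternionGroup.a 2) :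
    diagElt r q * diagElt r q = zElt r :=
  Prod.ext (by decide : Multiplicative.ofAdd (1 : ZMod 4) * Multiplicative.ofAdd 1 =
    Multiplicative.ofAdd 2) (Prod.ext hq (one_mul 1))

lemma not_normal_zpowers_diagElt {p q : QuaternionGroup 2} (hq : q * q = QuaternionGroup.a 2)
    (hpq : p * q * p⁻¹ ≠ q) : ¬ (Subgroup.zpowers (diagElt r q)).Normal := by
  intro hn
  have h := hn.conj_mem _ (Subgroup.mem_zpowers (diagElt r q)) (1, p, 1)
  rw [mem_zpowers_iff_of_sq (diagElt_mul_self hq)] at h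
  rcases h with h | h | h | h
  · exact absurd (congrArg Prod.fst h) (by decide : (1 : Multiplicative (ZMod 4)) *
      Multiplicative.ofAdd 1 * 1⁻¹ ≠ 1)
  · exact hpq (congrArg (fun g => g.2.1) h)
  · exact absurd (congrArg Prod.fst h) (by decide : (1 : Multiplicative (ZMod 4)) *
      Multiplicative.ofAdd 1 * 1⁻¹ ≠ Multiplicative.ofAdd 2)
  · exact absurd (congrArg Prod.fst h) (by decide : (1 : Multiplicative (ZMod 4)) *
      Multiplicative.ofAdd 1 * 1⁻¹ ≠ Multiplicative.ofAdd 2 * Multiplicative.ofAdd 1)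

lemma mem_zpowers_zElt_of_mem_diagElt {g : Grp r}
    (h1 : g ∈ Subgroup.zpowers (diagElt r (QuaternionGroup.a 1)))
    (h2 : g ∈ Subgroup.zpowers (diagElt r (QuaternionGroup.xa 0))) :
    g ∈ Subgroup.zpowers (zElt r) := by
  rw [mem_zpowers_iff_of_sq (diagElt_mul_self (by decide))] at h1 h2
  rcases h1 with rfl | rfl | rfl | rfl
  · exact one_mem _
  · exfalso
    rcases h2 with h | h | h | h <;>
      exact absurd (congrArg (fun g : Grp r => (g.1, g.2.1)) h) (by
        simp only [Prod.fst_mul, Prod.snd_mul, Prod.fst_one, Prod.snd_one]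
        decide)
  · exact Subgroup.mem_zpowers _
  · exfalso
    rcases h2 with h | h | h | h <;>
      exact absurd (congrArg (fun g : Grp r => (g.1, g.2.1)) h) (by
        simp only [Prod.fst_mul, Prod.snd_mul, Prod.fst_one, Prod.snd_one]
        decide)

lemma zpowers_zElt_eq_iInf :
    Subgroup.zpowers (zElt r) = ⨅ U ∈ {U : Subgroup (Grp r) | ¬ U.Normal}, U := by
  refine le_antisymm ?_ fun g hg => ?_
  · simp only [Set.mem_ofPred_eq, le_iInf_iff, Subgroup.zpowers_le]
    exact fun U hU => zElt_mem_of_not_normal hU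
  · simp only [Set.mem_ofPred_eq, Subgroup.mem_iInf] at hg
    exact mem_zpowers_zElt_of_mem_diagElt
      (hg _ (not_normal_zpowers_diagElt (p := QuaternionGroup.xa 0) (by decide) (by decide)))
      (hg _ (not_normal_zpowers_diagElt (p := QuaternionGroup.a 1) (by decide) (by decide)))

end HamiltonianTimesC4

theorem stmt15 (r : ℕ) (u : Multiplicative (ZMod 4)) (hu : Subgroup.zpowers u = ⊤)
    (x : QuaternionGroup 2) (hx : orderOf x = 4) :
    ((u ^ 2, x ^ 2, 1) :
        Multiplicative (ZMod 4) × QuaternionGroup 2 × (Fin r → Multiplicative (ZMod 2)))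
      ≠ 1 ∧
    Subgroup.zpowers
        ((u ^ 2, x ^ 2, 1) :
          Multiplicative (ZMod 4) × QuaternionGroup 2 × (Fin r → Multiplicative (ZMod 2)))
      = ⨅ U ∈ {U : Subgroup (Multiplicative (ZMod 4) × QuaternionGroup 2 ×
          (Fin r → Multiplicative (ZMod 2))) | ¬ U.Normal}, U ∧
    IsNKW ℝ (Subgroup.zpowers
        ((u ^ 2, x ^ 2, 1) :
          Multiplicative (ZMod 4) × QuaternionGroup 2 ×
            (Fin r → Multiplicative (ZMod 2)))) := by
  rw [sq_eq_of_zpowers_eq_top hu, QuaternionGroup.sq_eq_of_orderOf_eq_four hx]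
  exact ⟨HamiltonianTimesC4.zElt_ne_one, HamiltonianTimesC4.zpowers_zElt_eq_iInf,
    isNKW_zpowers HamiltonianTimesC4.zElt_ne_one HamiltonianTimesC4.mul_zElt
      HamiltonianTimesC4.zElt_mul_self HamiltonianTimesC4.mul_inv_trichotomy⟩
end

section
/- Let q be a prime, Q a finite abelian q-group, and P a finite group with gcd(|P|,|Q|) = 1 acting on Q by automorphisms via φ : P → Aut(Q), such that every subgroup of Q is invariant under φ(u) for every u ∈ P. Then the quotient P/ker φ is cyclic of order dividing q−1, and for every x ∈ Q with x ≠ 1 the stabilizer {u ∈ P : φ(u)(x) = x} equals ker φ. -/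
/-- A nontrivial element `x` of a `q`-group has order `q ^ (m + 1)` for some `m`, and then
`x ^ q ^ m` has order `q`. -/
theorem IsPGroup.exists_orderOf_pow_eq_prime {q : ℕ} (hq : q.Prime) {G : Type*} [Group G]
    (hG : IsPGroup q G) {x : G} (hx : x ≠ 1) :
    ∃ m, orderOf x = q ^ (m + 1) ∧ orderOf (x ^ q ^ m) = q := by
  have := Fact.mk hq
  obtain ⟨n, hn⟩ := IsPGroup.iff_orderOf.mp hG x
  obtain _ | m := n
  · exact absurd (orderOf_eq_one_iff.mp (by simpa using hn)) hx
  · refine ⟨m, hn, ?_⟩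
    rw [orderOf_pow_of_dvd (pow_ne_zero _ hq.ne_zero) (hn ▸ pow_dvd_pow q m.le_succ), hn,
      pow_succ', Nat.mul_div_cancel _ (pow_pos hq.pos m)]

theorem dvd_sub_one_of_zpow_eq_self {G : Type*} [Group G] {x : G} {k : ℤ} (h : x ^ k = x) :
    (orderOf x : ℤ) ∣ k - 1 := by
  rw [orderOf_dvd_iff_zpow_eq_one, zpow_sub, h, zpow_one, mul_inv_cancel]

/-- An automorphism preserving every subgroup and fixing one element of prime order `q` fixes
every element of order `q`. -/
theorem MulAut.apply_eq_self_of_orderOf_eq_prime {q : ℕ} (hq : q.Prime) {A : Type*} [CommGroup A]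
    (f : MulAut A) (hf : ∀ S : Subgroup A, ∀ a ∈ S, f a ∈ S) {x y : A} (hx : orderOf x = q)
    (hy : orderOf y = q) (hfx : f x = x) : f y = y := by
  by_cases hmem : y ∈ Subgroup.zpowers x
  · obtain ⟨n, rfl⟩ := hmem
    simp only [map_zpow, hfx]
  obtain ⟨k, hk⟩ := hf _ _ (Subgroup.mem_zpowers (x * y))
  obtain ⟨l, hl⟩ := hf _ _ (Subgroup.mem_zpowers y)
  simp only [map_mul, hfx, mul_zpow] at hk hl
  have hkl : y ^ (k - l) = x ^ (1 - k) := by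
    rw [zpow_sub, zpow_sub, zpow_one, hl, mul_inv_eq_iff_eq_mul, mul_right_comm,
      eq_mul_inv_iff_mul_eq, mul_comm, hk]
  have hdvd : (q : ℤ) ∣ k - l := by
    by_contra hnd
    obtain ⟨a, b, hab⟩ := (Nat.prime_iff_prime_int.mp hq).coprime_iff_not_dvd.mpr hnd
    refine hmem ?_
    have hyq : y ^ (q : ℤ) = 1 := by rw [zpow_natCast, ← hy, pow_orderOf_eq_one]
    have : y = (x ^ (1 - k)) ^ b := by
      calc y = y ^ (a * q + b * (k - l)) := by rw [hab, zpow_one]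
        _ = (x ^ (1 - k)) ^ b := by
          rw [zpow_add, mul_comm a, zpow_mul, hyq, one_zpow, one_mul, mul_comm b, zpow_mul, hkl]
    rw [this]
    exact zpow_mem (zpow_mem (Subgroup.mem_zpowers x) _) _
  have hyk : y ^ k = f y := by
    rw [← hl, ← mul_inv_eq_one, ← zpow_sub, ← orderOf_dvd_iff_zpow_eq_one, hy]
    exact hdvd
  have hxk : x ^ k = x := by
    rw [hyk] at hk
    exact mul_right_cancel hk
  rw [← hyk, ← mul_inv_eq_one]
  nth_rw 2 [← zpow_one y]
  rw [← zpow_sub, ← orderOf_dvd_iff_zpow_eq_one, hy, ← hx]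
  exact dvd_sub_one_of_zpow_eq_self hxk

theorem MulAut.pow_apply_eq_zpow {G : Type*} [Group G] (f : MulAut G) {y : G} {k : ℤ}
    (h : f y = y ^ k) (n : ℕ) : (f ^ n) y = y ^ k ^ n := by
  induction n with
  | zero => simp
  | succ n ih => rw [pow_succ', MulAut.mul_apply, ih, map_zpow, h, ← zpow_mul, pow_succ']

/-- An automorphism of order prime to `q` of an abelian `q`-group that preserves every subgroup
and fixes a nontrivial element is trivial. -/
theorem MulAut.eq_one_of_apply_eq_self {q : ℕ} (hq : q.Prime) {A : Type*} [CommGroup A]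
    (hA : IsPGroup q A) (f : MulAut A) (hcop : q.Coprime (orderOf f))
    (hf : ∀ S : Subgroup A, ∀ a ∈ S, f a ∈ S) {x : A} (hx : x ≠ 1) (hfx : f x = x) : f = 1 := by
  ext y
  rw [MulAut.one_apply]
  obtain rfl | hy := eq_or_ne y 1
  · exact map_one f
  obtain ⟨n, -, hn⟩ := hA.exists_orderOf_pow_eq_prime hq hx
  obtain ⟨m, hm, hm'⟩ := hA.exists_orderOf_pow_eq_prime hq hy
  have hz : f (y ^ q ^ m) = y ^ q ^ m :=
    f.apply_eq_self_of_orderOf_eq_prime hq hf hn hm' (by rw [map_pow, hfx])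
  obtain ⟨k, hk⟩ := hf _ _ (Subgroup.mem_zpowers y)
  have hk' : f y = y ^ k := hk.symm
  have hdvd : (q : ℤ) ∣ k - 1 := by
    have h : (y ^ q ^ m) ^ k = y ^ q ^ m := by
      rw [← zpow_natCast, zpow_comm, zpow_natCast, ← hk', ← map_pow, hz, zpow_natCast]
    simpa only [hm'] using dvd_sub_one_of_zpow_eq_self h
  have hfix : (f ^ q ^ m) y = y := by
    have h := dvd_sub_pow_of_dvd_sub hdvd m
    rw [one_pow, ← Nat.cast_pow, ← hm, orderOf_dvd_iff_zpow_eq_one, zpow_sub, zpow_one,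
      mul_inv_eq_one] at h
    rw [f.pow_apply_eq_zpow hk', h]
  obtain ⟨j, hj⟩ := exists_pow_eq_self_of_coprime (hcop.pow_left m)
  have h := MulAut.pow_apply_eq_zpow (f ^ q ^ m) (k := 1) (by rw [hfix, zpow_one]) j
  rwa [hj, one_pow, zpow_one] at h

/-- The action on an invariant subgroup induced by an action by automorphisms. -/
def MonoidHom.restrictMulAut {P G : Type*} [Group P] [Group G] (φ : P →* MulAut G)
    (H : Subgroup G) (hH : ∀ u, ∀ a ∈ H, φ u a ∈ H) : P →* MulAut H where
  toFun u :=
    { toFun a := ⟨φ u a, hH u a a.2⟩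
      invFun a := ⟨φ u⁻¹ a, hH u⁻¹ a a.2⟩
      left_inv a := by simp
      right_inv a := by simp
      map_mul' a b := by simp }
  map_one' := by ext; simp
  map_mul' u v := by ext; simp

theorem stmt16 (q : ℕ) (hq : q.Prime)
    (Q : Type*) [Group Q] [Finite Q] (hQcomm : ∀ a b : Q, a * b = b * a)
    (hQq : IsPGroup q Q)
    (P : Type*) [Group P] [Finite P]
    (hcop : Nat.Coprime (Nat.card P) (Nat.card Q))
    (φ : P →* MulAut Q)
    (hinv : ∀ (u : P) (S : Subgroup Q), ∀ x ∈ S, φ u x ∈ S) :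
    (IsCyclic (P ⧸ φ.ker) ∧ Nat.card (P ⧸ φ.ker) ∣ q - 1) ∧
    ∀ x : Q, x ≠ 1 → ∀ u : P, (φ u x = x ↔ u ∈ φ.ker) := by
  have := Fact.mk hq
  have hstab : ∀ x : Q, x ≠ 1 → ∀ u : P, (φ u x = x ↔ u ∈ φ.ker) := by
    refine fun x hx u ↦ ⟨fun h ↦ ?_, fun h ↦ by rw [MonoidHom.mem_ker.mp h, MulAut.one_apply]⟩
    obtain ⟨m, -, hm⟩ := hQq.exists_orderOf_pow_eq_prime hq hx
    have hqQ : q ∣ Nat.card Q := hm ▸ orderOf_dvd_natCard (x ^ q ^ m)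
    have hqu : q.Coprime (orderOf (φ u)) := (hcop.symm.coprime_dvd_left hqQ).coprime_dvd_right
      ((orderOf_map_dvd φ u).trans (orderOf_dvd_natCard u))
    let _ : CommGroup Q := { ‹Group Q› with mul_comm := hQcomm }
    exact MulAut.eq_one_of_apply_eq_self hq hQq (φ u) hqu (hinv u) hx h
  refine ⟨?_, hstab⟩
  by_cases hQ : ∃ x : Q, x ≠ 1
  · obtain ⟨y, hy⟩ := hQ
    obtain ⟨m, -, hm⟩ := hQq.exists_orderOf_pow_eq_prime hq hy
    set x := y ^ q ^ m
    have hx : x ≠ 1 := fun h ↦ hq.one_lt.ne (by rw [← hm, h, orderOf_one])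
    let H := Subgroup.zpowers x
    have hH : Nat.card H = q := by rw [Nat.card_zpowers, hm]
    have := Fact.mk (hH.symm ▸ hq : (Nat.card H).Prime)
    let ψ := φ.restrictMulAut H fun u ↦ hinv u H
    have hker : φ.ker = ψ.ker := by
      ext u
      refine ⟨fun h ↦ ?_, fun h ↦ (hstab x hx u).mp ?_⟩
      · ext a
        exact congrArg (fun g : MulAut Q ↦ g a) (MonoidHom.mem_ker.mp h)
      · exact congrArg (fun g : MulAut H ↦ (g ⟨x, Subgroup.mem_zpowers x⟩ : Q))
          (MonoidHom.mem_ker.mp h)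
    let ι : P ⧸ φ.ker →* (ZMod (Nat.card H))ˣ :=
      ((IsCyclic.mulAutMulEquiv H).toMonoidHom.comp (QuotientGroup.kerLift ψ)).comp
        (QuotientGroup.quotientMulEquivOfEq hker).toMonoidHom
    have hι : Function.Injective ι := ((IsCyclic.mulAutMulEquiv H).injective.comp
      (QuotientGroup.kerLift_injective ψ)).comp
        (QuotientGroup.quotientMulEquivOfEq hker).injective
    refine ⟨isCyclic_of_injective ι hι, ?_⟩
    have h := Subgroup.card_dvd_of_injective ι hι
    rwa [Nat.card_eq_fintype_card (α := (ZMod (Nat.card H))ˣ), ZMod.card_units, hH] at h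
  · push Not at hQ
    have htop : φ.ker = ⊤ := by
      ext u
      simp only [Subgroup.mem_top, iff_true, MonoidHom.mem_ker]
      ext a
      rw [hQ (φ u a), MulAut.one_apply, hQ a]
    have : Subsingleton (P ⧸ φ.ker) := by
      rw [htop]
      exact QuotientGroup.subsingleton_quotient_top
    exact ⟨inferInstance, by simp⟩
end

section
/- Let G = Q₈ × (C₂)^r × H, where r ≥ 0 and H is a nontrivial finite group of odd order. Then some nontrivial normal subgroup of G is a nonideal-kernel witness over ℚ if and only if some nontrivial normal subgroup of H is a nonideal-kernel witness over ℚ (with respect to the group algebra ℚ[H]) and the multiplicative order of 2 modulo |H| is odd. -/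
open scoped BigOperators

open scoped TensorProduct Quaternion

theorem two_pow_eq_neg_one {p : ℕ} [Fact p.Prime] (hp : ¬ Odd (orderOf (2 : ZMod p)))
    (h2 : (2 : ZMod p) ≠ 0) : ∃ s : ℕ, (2 : ZMod p) ^ s = -1 := by
  obtain ⟨s, hs⟩ := Nat.not_odd_iff_even.mp hp
  have hpos : 0 < orderOf (2 : ZMod p) :=
    orderOf_pos_iff.mpr (isOfFinOrder_iff_pow_eq_one.mpr
      ⟨p - 1, Nat.sub_pos_of_lt (Fact.out : p.Prime).one_lt, ZMod.pow_card_sub_one_eq_one h2⟩)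
  refine ⟨s, ?_⟩
  have h1 : (2 : ZMod p) ^ s * 2 ^ s = 1 := by rw [← pow_add, ← hs, pow_orderOf_eq_one]
  rcases mul_self_eq_one_iff.mp h1 with h | h
  · exact absurd (orderOf_le_of_pow_eq_one (by omega) h) (by omega)
  · exact h

theorem exists_odd_two_pow {n : ℕ} (hn : n ≠ 0)
    (h : ∀ p : ℕ, p.Prime → p ∣ n → Odd (orderOf (2 : ZMod p))) :
    ∃ t, Odd t ∧ (n : ℤ) ∣ 2 ^ t - 1 := by
  induction n using Nat.recOnMul with
  | zero => exact absurd rfl hn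
  | one => exact ⟨1, odd_one, by norm_num⟩
  | prime p hp =>
    refine ⟨_, h p hp dvd_rfl, ?_⟩
    rw [← ZMod.intCast_zmod_eq_zero_iff_dvd]
    push_cast
    rw [pow_orderOf_eq_one, sub_self]
  | mul a b iha ihb =>
    obtain ⟨ha, hb⟩ := mul_ne_zero_iff.mp hn
    obtain ⟨t, ht, hta⟩ := iha ha fun p hp hpa => h p hp (hpa.mul_right b)
    obtain ⟨u, hu, hub⟩ := ihb hb fun p hp hpb => h p hp (hpb.mul_left a)
    have hb_odd : Odd b := by
      have : Odd ((2 : ℤ) ^ u - 1) := (even_two.pow_of_ne_zero hu.pos.ne').sub_odd odd_one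
      obtain ⟨c, hc⟩ := hub
      rw [hc, Int.odd_mul] at this
      exact_mod_cast this.1
    refine ⟨t * u * b, (ht.mul hu).mul hb_odd, ?_⟩
    set x : ℤ := 2 ^ (t * u) with hx
    have hxa : (a : ℤ) ∣ x - 1 := hta.trans (by
      rw [hx, pow_mul]; simpa using sub_dvd_pow_sub_pow ((2 : ℤ) ^ t) 1 u)
    have hxb : (b : ℤ) ∣ x - 1 := hub.trans (by
      rw [hx, mul_comm, pow_mul]; simpa using sub_dvd_pow_sub_pow ((2 : ℤ) ^ u) 1 t)
    have hsum : (b : ℤ) ∣ ∑ i ∈ Finset.range b, x ^ i := by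
      rw [← ZMod.intCast_zmod_eq_zero_iff_dvd] at hxb ⊢
      push_cast at hxb ⊢
      simp [sub_eq_zero.mp hxb]
    rw [pow_mul, ← hx, ← mul_geom_sum, Nat.cast_mul]
    exact mul_dvd_mul hxa hsum

theorem odd_orderOf_two_of_dvd {n t : ℕ} (ht : Odd t) (h : (n : ℤ) ∣ 2 ^ t - 1) :
    Odd (orderOf (2 : ZMod n)) := by
  refine ht.of_dvd_nat (orderOf_dvd_of_pow_eq_one ?_)
  rw [← ZMod.intCast_zmod_eq_zero_iff_dvd] at h
  push_cast at h
  exact sub_eq_zero.mp h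

theorem eq_zero_of_sq_add_mul_add_sq {Q : Type*} [CommRing Q] (h2 : (2 : Q) = 0) {f : ℕ}
    (hf : Odd f) (hQ : ∀ x : Q, x ^ 2 ^ f = x) {u v : Q} (h : u ^ 2 + u * v + v ^ 2 = 0) :
    u = 0 := by
  obtain ⟨q, hq⟩ : ∃ q, 2 ^ f = 3 * q + 2 := by
    obtain ⟨k, rfl⟩ := hf
    refine ⟨2 ^ (2 * k + 1) / 3, ?_⟩
    have h4 : 4 ^ k % 3 = 1 := by simp [Nat.pow_mod]
    have : 2 ^ (2 * k + 1) = 2 * 4 ^ k := by rw [pow_succ, pow_mul]; ring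
    rw [this]
    omega
  have hE : ∀ x : Q, x = (x ^ 3) ^ q * x ^ 2 := fun x => by
    rw [← pow_mul, ← pow_add, ← hq, hQ]
  have h3 : v ^ 3 = u ^ 3 := by linear_combination (v - u) * h
  have hu := hE u
  have hv := hE v
  rw [h3] at hv
  generalize (u ^ 3) ^ q = E at hu hv
  have hEu : E * u = 0 := by
    linear_combination (E * u * E ^ 2) * h + (1 + E * u + E * v) * E * hu + E * u * E * hv
      - E * u * (E * v) * h2
  rw [hu]
  linear_combination u * hEu

theorem two_dvd_of_sum_four_sq {R : Type*} [CommRing R] [IsDomain R] [CharZero R] {f : ℕ}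
    (hf : Odd f) (hR : ∀ x : R, 2 ∣ x ^ 2 ^ f - x) {a b c d : R}
    (h : a ^ 2 + b ^ 2 + c ^ 2 + d ^ 2 = 0) : 2 ∣ a := by
  let φ := Ideal.Quotient.mk (Ideal.span {(2 : R)})
  have hφ : ∀ x, φ x = 0 ↔ 2 ∣ x := fun x => by
    rw [Ideal.Quotient.eq_zero_iff_mem, Ideal.mem_span_singleton]
  have h2 : (2 : R ⧸ Ideal.span {(2 : R)}) = 0 := by
    rw [← map_ofNat φ 2, hφ]
  have hQ : ∀ x : R ⧸ Ideal.span {(2 : R)}, x ^ 2 ^ f = x := fun x => by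
    obtain ⟨x, rfl⟩ := Ideal.Quotient.mk_surjective x
    have := (hφ _).mpr (hR x)
    rw [map_sub, map_pow] at this
    exact sub_eq_zero.mp this
  have hsq : ∀ x : R, 2 ∣ x ^ 2 → 2 ∣ x := fun x hx => by
    rw [← hφ, ← hQ (φ x), ← map_pow, hφ]
    refine hx.trans (pow_dvd_pow x ?_)
    exact Nat.le_self_pow hf.pos.ne' 2
  have h20 : (2 : R) ≠ 0 := two_ne_zero
  obtain ⟨s, hs⟩ : 2 ∣ a + b + c + d := hsq _ ⟨a * b + a * c + a * d + b * c + b * d + c * d, by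
    linear_combination h⟩
  have he : a * b + a * c + a * d + b * c + b * d + c * d = 2 * s ^ 2 := by
    apply mul_left_cancel₀ h20
    linear_combination (a + b + c + d + 2 * s) * hs - h
  have hform : ∀ x y z w t : R, x + y + z + w = 2 * t →
      x * y + x * z + x * w + y * z + y * w + z * w = 2 * s ^ 2 → φ (x + y) = 0 := by
    intro x y z w t ht hxy
    refine eq_zero_of_sq_add_mul_add_sq (v := φ (y + z)) h2 hf hQ ?_
    rw [← map_pow, ← map_mul, ← map_pow, ← map_add, ← map_add, hφ]
    obtain rfl : w = 2 * t - (x + y + z) := by linear_combination ht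
    exact ⟨t * (x + y + z) - s ^ 2 + y ^ 2 + x * y + y * z, by linear_combination -hxy⟩
  obtain ⟨β, hβ⟩ := (hφ _).mp (hform a b c d s hs he)
  obtain ⟨γ, hγ⟩ := (hφ _).mp (hform a c b d s (by linear_combination hs) (by linear_combination he))
  obtain ⟨δ, hδ⟩ := (hφ _).mp (hform a d c b s (by linear_combination hs) (by linear_combination he))
  rw [← hφ]
  refine eq_zero_of_sq_add_mul_add_sq (v := φ (β + γ + δ)) h2 hf hQ ?_
  rw [← map_pow, ← map_mul, ← map_pow, ← map_add, ← map_add, hφ]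
  obtain rfl : b = 2 * β - a := by linear_combination hβ
  obtain rfl : c = 2 * γ - a := by linear_combination hγ
  obtain rfl : d = 2 * δ - a := by linear_combination hδ
  refine ⟨a * (β + γ + δ) + β * γ + β * δ + γ * δ, ?_⟩
  apply mul_left_cancel₀ (mul_ne_zero h20 h20)
  linear_combination h

theorem sum_four_sq_eq_zero {R : Type*} [CommRing R] [IsDomain R] [CharZero R]
    [IsNoetherianRing R] (hu : ¬ IsUnit (2 : R)) {f : ℕ} (hf : Odd f)
    (hR : ∀ x : R, 2 ∣ x ^ 2 ^ f - x) {a b c d : R}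
    (h : a ^ 2 + b ^ 2 + c ^ 2 + d ^ 2 = 0) : a = 0 := by
  have key : ∀ n : ℕ, ∀ a b c d : R, a ^ 2 + b ^ 2 + c ^ 2 + d ^ 2 = 0 → 2 ^ n ∣ a := by
    intro n
    induction n with
    | zero => simp
    | succ n ih =>
      intro a b c d h
      obtain ⟨a, rfl⟩ := two_dvd_of_sum_four_sq hf hR h
      obtain ⟨b, rfl⟩ := two_dvd_of_sum_four_sq (a := b) (b := 2 * a) (c := c) (d := d) hf hR
        (by linear_combination h)
      obtain ⟨c, rfl⟩ := two_dvd_of_sum_four_sq (a := c) (b := 2 * a) (c := 2 * b) (d := d) hf hR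
        (by linear_combination h)
      obtain ⟨d, rfl⟩ := two_dvd_of_sum_four_sq (a := d) (b := 2 * a) (c := 2 * b) (d := 2 * c)
        hf hR (by linear_combination h)
      rw [pow_succ']
      refine mul_dvd_mul_left 2 (ih a b c d (mul_left_cancel₀ (pow_ne_zero 2 two_ne_zero) ?_))
      linear_combination h
  by_contra ha
  obtain ⟨n, hn⟩ := FiniteMultiplicity.of_not_isUnit hu ha
  exact hn (key _ a b c d h)

open Polynomial in
/-- If `ζ` is an odd-order root of unity of order dividing `2 ^ t - 1` with `t` odd, then the sum
of four squares is anisotropic over `ℚ(ζ)`. -/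
theorem sum_four_sq_eq_zero_of_adjoin {L : Type*} [Field L] [Algebra ℚ L] {ζ : L} {n t : ℕ}
    (hn : n ≠ 0) (hζ : ζ ^ n = 1) (ht : Odd t) (hnt : (n : ℤ) ∣ 2 ^ t - 1)
    (hL : ∀ x : L, ∃ P : ℚ[X], aeval ζ P = x)
    {a b c d : L} (h : a ^ 2 + b ^ 2 + c ^ 2 + d ^ 2 = 0) : a = 0 := by
  have : CharZero L := algebraRat.charZero L
  have h_integral : IsIntegral ℤ ζ := ⟨X ^ n - 1, monic_X_pow_sub_C 1 hn, by simp [hζ]⟩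
  let R := Algebra.adjoin ℤ {ζ}
  have : Module.Finite ℤ R := Algebra.finite_adjoin_simple_of_isIntegral h_integral
  have : IsNoetherianRing R := IsNoetherianRing.of_finite ℤ R
  have hR : ∀ x : R, 2 ∣ x ^ 2 ^ t - x := by
    rintro ⟨x, hx⟩
    induction hx using Algebra.adjoin_induction with
    | mem x hx =>
      obtain rfl : x = ζ := hx
      have : x ^ 2 ^ t = x := by
        obtain ⟨k, hk⟩ : n ∣ 2 ^ t - 1 := by
          rw [← Int.natCast_dvd_natCast]
          push_cast [Nat.one_le_two_pow]
          exact hnt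
        rw [show 2 ^ t = n * k + 1 by have := Nat.one_le_two_pow (n := t); omega, pow_add, pow_mul,
          hζ, one_pow, one_mul, pow_one]
      exact ⟨0, Subtype.ext (by simp [this])⟩
    | algebraMap k =>
      have hk : (2 : ℤ) ∣ k ^ 2 ^ t - k := by
        rw [← even_iff_two_dvd, Int.even_sub, Int.even_pow' (by positivity)]
      have := map_dvd (algebraMap ℤ R) hk
      rwa [map_sub, map_pow, map_ofNat] at this
    | add x y hx hy ihx ihy =>
      obtain ⟨r, hr⟩ := exists_add_pow_prime_pow_eq Nat.prime_two (⟨x, hx⟩ : R) ⟨y, hy⟩ t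
      change 2 ∣ ((⟨x, hx⟩ + ⟨y, hy⟩ : R)) ^ 2 ^ t - (⟨x, hx⟩ + ⟨y, hy⟩)
      rw [hr]
      obtain ⟨p, hp⟩ := ihx
      obtain ⟨q, hq⟩ := ihy
      exact ⟨p + q + ⟨x, hx⟩ * ⟨y, hy⟩ * r, by push_cast; linear_combination hp + hq⟩
    | mul x y hx hy ihx ihy =>
      change 2 ∣ ((⟨x, hx⟩ * ⟨y, hy⟩ : R)) ^ 2 ^ t - (⟨x, hx⟩ * ⟨y, hy⟩)
      obtain ⟨p, hp⟩ := ihx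
      obtain ⟨q, hq⟩ := ihy
      exact ⟨p * ⟨y, hy⟩ ^ 2 ^ t + ⟨x, hx⟩ * q, by
        rw [mul_pow]
        linear_combination ⟨y, hy⟩ ^ 2 ^ t * hp + ⟨x, hx⟩ * hq⟩
  have hu : ¬ IsUnit (2 : R) := by
    intro h2
    rw [← map_ofNat (algebraMap ℤ R) 2] at h2
    exact absurd (isUnit_of_map_unit _ _ h2) (by decide)
  have hden : ∀ x : L, ∃ N : ℕ, N ≠ 0 ∧ ∃ y : R, N * x = y := by
    intro x
    obtain ⟨P, rfl⟩ := hL x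
    induction P using Polynomial.induction_on' with
    | add p q hp hq =>
      obtain ⟨N, hN, y, hy⟩ := hp
      obtain ⟨M, hM, z, hz⟩ := hq
      refine ⟨N * M, mul_ne_zero hN hM, M * y + N * z, ?_⟩
      push_cast
      rw [← hy, ← hz, map_add]
      ring
    | monomial k q =>
      refine ⟨q.den, q.den_ne_zero, q.num * ⟨ζ, Algebra.self_mem_adjoin_singleton ℤ ζ⟩ ^ k, ?_⟩
      have : (q.den : L) * algebraMap ℚ L q = q.num := by
        rw [← map_natCast (algebraMap ℚ L), ← map_mul, Rat.den_mul_eq_num, map_intCast]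
      rw [aeval_monomial, ← mul_assoc, this]
      push_cast
      rfl
  obtain ⟨Na, hNa, a', ha⟩ := hden a
  obtain ⟨Nb, hNb, b', hb⟩ := hden b
  obtain ⟨Nc, hNc, c', hc⟩ := hden c
  obtain ⟨Nd, hNd, d', hd⟩ := hden d
  have : Nb * Nc * Nd * a' = 0 := by
    refine sum_four_sq_eq_zero hu ht hR (b := Na * Nc * Nd * b') (c := Na * Nb * Nd * c')
      (d := Na * Nb * Nc * d') (Subtype.ext ?_)
    push_cast
    rw [← ha, ← hb, ← hc, ← hd]
    linear_combination ((Na : L) * Nb * Nc * Nd) ^ 2 * h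
  have ha0 : (a' : L) = 0 := by simpa [hNb, hNc, hNd] using this
  simpa [ha0, hNa] using ha

theorem finrank_dvd_finrank_leftIdeal {S R : Type*} [DivisionRing S] [Algebra ℚ S] [Ring R]
    [Algebra ℚ R] (φ : S →ₐ[ℚ] R) (V : Submodule R R) :
    Module.finrank ℚ S ∣ Module.finrank ℚ V := by
  let _ : Module S V := Module.compHom V φ.toRingHom
  have : IsScalarTower ℚ S V := ⟨fun q s v => by
    change φ (q • s) • v = q • (φ s • v)
    rw [map_smul, smul_assoc]⟩
  exact ⟨_, (Module.finrank_mul_finrank ℚ S V).symm⟩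

/-- The scalar extension of a quaternion basis. -/
noncomputable def QuaternionAlgebra.Basis.scalarExtension {A : Type*} [Ring A] [Algebra ℚ A]
    (q : QuaternionAlgebra.Basis A (-1 : ℚ) 0 (-1)) (L : Type*) [Field L] [Algebra ℚ L] :
    QuaternionAlgebra.Basis (L ⊗[ℚ] A) (-1 : L) 0 (-1) where
  i := 1 ⊗ₜ q.i
  j := 1 ⊗ₜ q.j
  k := 1 ⊗ₜ q.k
  i_mul_i := by
    simp [q.i_mul_i, Algebra.TensorProduct.one_def, TensorProduct.tmul_neg]
  j_mul_j := by
    simp [q.j_mul_j, Algebra.TensorProduct.one_def, TensorProduct.tmul_neg]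
  i_mul_j := by simp
  j_mul_i := by simp [q.j_mul_i, TensorProduct.tmul_neg]

theorem quaternion_isUnit_or_eq_zero {L : Type*} [Field L]
    (hL : ∀ a b c d : L, a ^ 2 + b ^ 2 + c ^ 2 + d ^ 2 = 0 → a = 0) (q : ℍ[L]) :
    IsUnit q ∨ q = 0 := by
  by_cases h : Quaternion.normSq q = 0
  · right
    rw [Quaternion.normSq_def'] at h
    ext
    · exact hL _ _ _ _ h
    · exact hL q.imI q.re q.imJ q.imK (by linear_combination h)
    · exact hL q.imJ q.re q.imI q.imK (by linear_combination h)
    · exact hL q.imK q.re q.imI q.imJ (by linear_combination h)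
  · left
    have hc : ((Quaternion.normSq q : L) : ℍ[L]) * ((Quaternion.normSq q)⁻¹ : L) = 1 := by
      rw [← Quaternion.coe_mul, mul_inv_cancel₀ h, Quaternion.coe_one]
    refine isUnit_iff_exists.mpr ⟨star q * ((Quaternion.normSq q)⁻¹ : L), ?_, ?_⟩
    · rw [← mul_assoc, Quaternion.self_mul_star, hc]
    · rw [← Quaternion.coe_commutes, mul_assoc, Quaternion.star_mul_self, Quaternion.coe_commutes,
        hc]

/-- If a proper nonzero left ideal exists in `D ⊗ ℍ`, then subfields `L` of `D` over which the
quaternions stay a division algebra have even left index. -/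
theorem dvd_finrank_of_leftIdeal {D L : Type*} [DivisionRing D] [Algebra ℚ D]
    [Module.Finite ℚ D] [Field L] [Algebra ℚ L] [Module.Finite ℚ L] (i : L →ₐ[ℚ] D)
    (hL : ∀ a b c d : L, a ^ 2 + b ^ 2 + c ^ 2 + d ^ 2 = 0 → a = 0)
    (V : Submodule (D ⊗[ℚ] ℍ[ℚ]) (D ⊗[ℚ] ℍ[ℚ])) (hbot : V ≠ ⊥) (htop : V ≠ ⊤) :
    2 * Module.finrank ℚ L ∣ Module.finrank ℚ D := by
  let φ : ℍ[L] →ₐ[ℚ] D ⊗[ℚ] ℍ[ℚ] :=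
    (Algebra.TensorProduct.map i (AlgHom.id ℚ ℍ[ℚ])).comp
      (((QuaternionAlgebra.Basis.self ℚ).scalarExtension L).liftHom.restrictScalars ℚ)
  let _ : DivisionRing ℍ[L] := DivisionRing.ofIsUnitOrEqZero (quaternion_isUnit_or_eq_zero hL)
  have h1 := finrank_dvd_finrank_leftIdeal φ V
  have h2 := finrank_dvd_finrank_leftIdeal
    (Algebra.TensorProduct.includeLeft : D →ₐ[ℚ] D ⊗[ℚ] ℍ[ℚ]) V
  rw [← Module.finrank_mul_finrank ℚ L ℍ[L], Quaternion.finrank_eq_four] at h1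
  have hV : Module.finrank ℚ (D ⊗[ℚ] ℍ[ℚ]) = Module.finrank ℚ D * 4 := by
    rw [Module.finrank_tensorProduct, Quaternion.finrank_eq_four]
  have hlt : Module.finrank ℚ V < Module.finrank ℚ D * 4 := by
    rw [← hV]
    refine Submodule.finrank_lt (s := V.restrictScalars ℚ) ?_
    simpa using htop
  have hpos : 0 < Module.finrank ℚ V := by
    have := (Submodule.nontrivial_iff_ne_bot).mpr hbot
    exact Module.finrank_pos (R := ℚ) (M := V)
  have h3 : Module.finrank ℚ L ∣ Module.finrank ℚ D := by
    let _ : Module L D := Module.compHom D i.toRingHom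
    have : IsScalarTower ℚ L D := ⟨fun q l d => by
      change i (q • l) * d = q • (i l * d)
      rw [map_smul, smul_mul_assoc]⟩
    exact ⟨_, (Module.finrank_mul_finrank ℚ L D).symm⟩
  obtain ⟨c, hc⟩ := h3
  obtain ⟨k, hk⟩ := h2
  obtain ⟨m, hm⟩ := h1
  have hl : 0 < Module.finrank ℚ L := Module.finrank_pos
  rw [hc] at hk
  have hk4 : k < 4 := lt_of_mul_lt_mul_left (a := Module.finrank ℚ L * c) (by rwa [← hk, ← hc])
    (Nat.zero_le _)
  have hk0 : k ≠ 0 := by rintro rfl; omega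
  have hck : c * k = 4 * m := by
    refine Nat.eq_of_mul_eq_mul_left hl ?_
    rw [← mul_assoc, ← mul_assoc, ← hk, hm]
  rw [hc, mul_comm 2]
  refine mul_dvd_mul_left _ ?_
  interval_cases k <;> omega

open Polynomial in
theorem exists_field_of_mem_divisionRing {D : Type*} [DivisionRing D] [Algebra ℚ D]
    [Module.Finite ℚ D] (g : D) :
    ∃ (L : Type) (_ : Field L) (_ : Algebra ℚ L) (_ : Module.Finite ℚ L) (i : L →ₐ[ℚ] D) (ζ : L),
      i ζ = g ∧ ∀ x : L, ∃ P : ℚ[X], aeval ζ P = x := by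
  have hg : IsIntegral ℚ g := Algebra.IsIntegral.isIntegral g
  let I : Ideal ℚ[X] := Ideal.span {minpoly ℚ g}
  have : I.IsMaximal := PrincipalIdealRing.isMaximal_of_irreducible (minpoly.irreducible hg)
  let i : (ℚ[X] ⧸ I) →ₐ[ℚ] D := Ideal.Quotient.liftₐ I (aeval g) fun a ha => by
    obtain ⟨c, rfl⟩ := Ideal.mem_span_singleton.mp ha
    rw [map_mul, minpoly.aeval, zero_mul]
  refine ⟨ℚ[X] ⧸ I, Ideal.Quotient.field I, inferInstance, ?_, i, Ideal.Quotient.mk I X, ?_, ?_⟩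
  · exact (minpoly.monic hg).finite_quotient
  · exact aeval_X g
  · intro x
    obtain ⟨P, rfl⟩ := Ideal.Quotient.mk_surjective x
    refine ⟨P, ?_⟩
    have := aeval_algHom_apply (Ideal.Quotient.mkₐ ℚ I) X P
    rw [aeval_X_left_apply] at this
    exact this

theorem trace_mulLeft_eq_finrank_mul {D L : Type*} [Ring D] [Algebra ℚ D] [Field L] [Algebra ℚ L]
    [Module.Finite ℚ D] [Module.Finite ℚ L] (i : L →ₐ[ℚ] D) (ζ : L) :
    Module.finrank ℚ L * LinearMap.trace ℚ D (LinearMap.mulLeft ℚ (i ζ)) =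
      Module.finrank ℚ D * Algebra.trace ℚ L ζ := by
  let _ : Module L D := Module.compHom D i.toRingHom
  have : IsScalarTower ℚ L D := ⟨fun q l d => by
    change i (q • l) * d = q • (i l * d)
    rw [map_smul, smul_mul_assoc]⟩
  have : Module.Finite L D := Module.Finite.of_restrictScalars_finite ℚ L D
  let b := Module.finBasis ℚ L
  let c := Module.finBasis L D
  have key : LinearMap.trace ℚ D (LinearMap.mulLeft ℚ (i ζ)) =
      Module.finrank L D * Algebra.trace ℚ L ζ := by
    have hs : ∀ p, LinearMap.mulLeft ℚ (i ζ) ((b.smulTower c) p) = (ζ * b p.1) • c p.2 := by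
      intro p
      rw [Module.Basis.smulTower_apply, mul_smul]
      rfl
    rw [LinearMap.trace_eq_matrix_trace ℚ (b.smulTower c), Algebra.trace_eq_matrix_trace b,
      Matrix.trace, Matrix.trace, Fintype.sum_prod_type_right]
    simp only [Matrix.diag_apply, LinearMap.toMatrix_apply, hs, Module.Basis.smulTower_repr, map_smul,
      Algebra.leftMulMatrix_eq_repr_mul]
    simp
  rw [key, ← mul_assoc, ← Nat.cast_mul, Module.finrank_mul_finrank]

theorem exists_trace_mulLeft_eq_two_mul {D : Type*} [DivisionRing D] [Algebra ℚ D]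
    [Module.Finite ℚ D] {n t : ℕ} (hn : n ≠ 0) (ht : Odd t) (hnt : (n : ℤ) ∣ 2 ^ t - 1)
    (V : Submodule (D ⊗[ℚ] ℍ[ℚ]) (D ⊗[ℚ] ℍ[ℚ])) (hbot : V ≠ ⊥) (htop : V ≠ ⊤)
    (g : D) (hg : g ^ n = 1) :
    ∃ k : ℤ, LinearMap.trace ℚ D (LinearMap.mulLeft ℚ g) = 2 * k := by
  obtain ⟨L, _, _, _, i, ζ, rfl, hL⟩ := exists_field_of_mem_divisionRing g
  have hζ : ζ ^ n = 1 := i.toRingHom.injective (by simpa using hg)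
  obtain ⟨m, hm⟩ := dvd_finrank_of_leftIdeal i
    (fun a b c d h => sum_four_sq_eq_zero_of_adjoin hn hζ ht hnt hL h) V hbot htop
  have h_integral : IsIntegral ℤ (Algebra.trace ℚ L ζ) := Algebra.isIntegral_trace
    ⟨Polynomial.X ^ n - 1, Polynomial.monic_X_pow_sub_C 1 hn, by simp [hζ]⟩
  obtain ⟨z, hz⟩ := IsIntegrallyClosed.isIntegral_iff.mp h_integral
  have := trace_mulLeft_eq_finrank_mul i ζ
  rw [hm, ← hz] at this
  have hl : (Module.finrank ℚ L : ℚ) ≠ 0 := Nat.cast_ne_zero.mpr Module.finrank_pos.ne'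
  refine ⟨m * z, mul_left_cancel₀ hl ?_⟩
  rw [this]
  push_cast
  simp only [eq_intCast]
  ring

theorem MonoidAlgebra.trace_mulLeft {K H : Type*} [Field K] [Group H] [Finite H]
    (z : MonoidAlgebra K H) :
    LinearMap.trace K _ (LinearMap.mulLeft K z) = Nat.card H * z.coeff 1 := by
  classical
  have := Fintype.ofFinite H
  rw [LinearMap.trace_eq_matrix_trace K (MonoidAlgebra.basis H K)]
  have : ∀ i, (LinearMap.toMatrix (MonoidAlgebra.basis H K) (MonoidAlgebra.basis H K)
      (LinearMap.mulLeft K z)).diag i = z.coeff 1 := by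
    intro i
    rw [Matrix.diag_apply, LinearMap.toMatrix_apply, MonoidAlgebra.basis_apply,
      LinearMap.mulLeft_apply]
    have := MonoidAlgebra.coeff_mul_single_apply z (1 : K) i i
    simp [MonoidAlgebra.basis] at this ⊢
  simp only [Matrix.trace, this]
  simp [Nat.card_eq_fintype_card]

/-- A division algebra quotient of `ℚ[H]`, split as a left ideal, stays reduced after tensoring
with the rational quaternions, when `|H|` is odd and divides `2 ^ t - 1` with `t` odd. -/
theorem eq_zero_of_isNilpotent_tensor_quaternion {H D : Type*} [Group H] [Finite H]
    [DivisionRing D] [Algebra ℚ D] [Module.Finite ℚ D] (hodd : Odd (Nat.card H)) {t : ℕ}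
    (ht : Odd t) (hdvd : (Nat.card H : ℤ) ∣ 2 ^ t - 1)
    (π : MonoidAlgebra ℚ H →ₐ[ℚ] D) (s : D →ₗ[ℚ] MonoidAlgebra ℚ H)
    (hπs : ∀ d, π (s d) = d) (hsπ : ∀ z, s (π z) = s 1 * z)
    (x : D ⊗[ℚ] ℍ[ℚ]) (hx : IsNilpotent x) : x = 0 := by
  classical
  have := Fintype.ofFinite H
  by_contra hx0
  have hn0 : Nat.card H ≠ 0 := Nat.card_pos.ne'
  have hbot : Ideal.span {x} ≠ ⊥ := by simpa [Ideal.span_singleton_eq_bot] using hx0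
  have htop : Ideal.span {x} ≠ ⊤ := by
    intro h
    obtain ⟨y, hy⟩ := Ideal.mem_span_singleton'.mp ((Ideal.eq_top_iff_one _).mp h)
    obtain ⟨k, hk⟩ := hx
    have : ∀ k, y ^ k * x ^ k = 1 := by
      intro k
      induction k with
      | zero => simp
      | succ k ih => rw [pow_succ, pow_succ', mul_assoc, ← mul_assoc y, hy, one_mul, ih]
    have h1 := this k
    rw [hk, mul_zero] at h1
    exact hx0 (by rw [← mul_one x, ← h1, mul_zero])
  have key := fun g : H => exists_trace_mulLeft_eq_two_mul hn0 ht hdvd (Ideal.span {x}) hbot htop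
    (π (MonoidAlgebra.single g 1)) (by
      rw [← map_pow, MonoidAlgebra.single_pow, pow_card_eq_one', one_pow,
        ← MonoidAlgebra.one_def, map_one])
  choose k hk using key
  have hfinA : Module.Finite ℚ (MonoidAlgebra ℚ H) :=
    Module.Finite.of_basis (MonoidAlgebra.basis H ℚ)
  have hco : ∀ g : H, (Nat.card H : ℚ) * (s 1).coeff g = 2 * (k g⁻¹ : ℚ) := by
    intro g
    rw [← hk g⁻¹]
    have h1 : LinearMap.mulLeft ℚ (s 1 * MonoidAlgebra.single g⁻¹ 1) =
        s ∘ₗ (LinearMap.mulLeft ℚ (π (MonoidAlgebra.single g⁻¹ 1)) ∘ₗ π.toLinearMap) := by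
      refine LinearMap.ext fun z => ?_
      rw [LinearMap.mulLeft_apply, mul_assoc, ← hsπ, map_mul]
      rfl
    have h2 := MonoidAlgebra.trace_mulLeft (s 1 * MonoidAlgebra.single g⁻¹ (1 : ℚ))
    rw [h1, LinearMap.trace_comp_comm', LinearMap.comp_assoc] at h2
    have h3 : π.toLinearMap ∘ₗ s = LinearMap.id := by ext d; exact hπs d
    rw [h3, LinearMap.comp_id] at h2
    rw [h2]
    congr 1
    have := MonoidAlgebra.coeff_mul_single_apply (s 1) (1 : ℚ) g⁻¹ 1
    simp at this ⊢
  set φ : MonoidAlgebra ℤ H →ₐ[ℤ] D :=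
    MonoidAlgebra.lift ℤ D H ((π : MonoidAlgebra ℚ H →* D).comp (MonoidAlgebra.of ℚ H)) with hφ
  have hw : (Nat.card H : D) = 2 * φ (∑ g, MonoidAlgebra.single g (k g⁻¹)) := by
    have h1 : (Nat.card H : ℚ) • s 1 = ∑ g, MonoidAlgebra.single g (2 * (k g⁻¹ : ℚ)) := by
      apply MonoidAlgebra.coeff_injective
      ext g
      rw [MonoidAlgebra.coeff_smul, Finsupp.smul_apply, smul_eq_mul, hco, MonoidAlgebra.coeff_sum,
        Finsupp.finsetSum_apply, Finset.sum_eq_single g]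
      · simp only [MonoidAlgebra.coeff_single, Finsupp.single_eq_same]
      · intro b _ hb
        simp only [MonoidAlgebra.coeff_single, Finsupp.single_eq_of_ne hb.symm]
      · simp
    have h2 := congrArg π h1
    rw [map_smul, hπs, map_sum] at h2
    rw [map_sum, Finset.mul_sum]
    have h3 : ((Nat.card H : ℚ) • (1 : D)) = (Nat.card H : D) := by
      rw [← Algebra.algebraMap_eq_smul_one]; simp
    rw [← h3, h2]
    refine Finset.sum_congr rfl fun g _ => ?_
    rw [hφ, MonoidAlgebra.lift_single]
    have h5 : (MonoidAlgebra.single g (2 * (k g⁻¹ : ℚ)) : MonoidAlgebra ℚ H) =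
        (2 * (k g⁻¹ : ℚ)) • MonoidAlgebra.single g 1 := by simp
    rw [h5, map_smul, mul_smul, Int.cast_smul_eq_zsmul]
    simp [two_mul, two_smul]
  have : Module.Finite ℤ (MonoidAlgebra ℤ H) := Module.Finite.of_basis (MonoidAlgebra.basis H ℤ)
  have h_integral := (Algebra.IsIntegral.isIntegral (R := ℤ)
    (∑ g, MonoidAlgebra.single g (k g⁻¹) : MonoidAlgebra ℤ H)).map φ
  have h4 : φ (∑ g, MonoidAlgebra.single g (k g⁻¹)) = algebraMap ℚ D ((Nat.card H : ℚ) / 2) := by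
    have : (2 : D) ≠ 0 := by
      have := (algebraMap ℚ D).injective.ne (two_ne_zero (α := ℚ)); simpa using this
    apply mul_left_cancel₀ this
    rw [← hw]
    have h5 : (2 : D) = algebraMap ℚ D 2 := by simp
    rw [h5, ← map_mul, mul_div_cancel₀ _ (two_ne_zero), map_natCast]
  rw [h4, isIntegral_algebraMap_iff (algebraMap ℚ D).injective] at h_integral
  obtain ⟨c, hc⟩ := IsIntegrallyClosed.isIntegral_iff.mp h_integral
  obtain ⟨l, hl⟩ := hodd
  rw [hl] at hc
  push_cast at hc
  have : (c : ℚ) * 2 = 2 * l + 1 := by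
    have : (c : ℚ) = (2 * l + 1) / 2 := by simpa using hc
    rw [this]; ring
  have : c * 2 = 2 * l + 1 := by exact_mod_cast this
  omega

/-- The rational quaternion with the given coordinates. -/
def Quaternion.ofCoords (a b c d : ℚ) : ℍ[ℚ] := ⟨a, b, c, d⟩

@[simp] theorem Quaternion.re_ofCoords (a b c d : ℚ) : (ofCoords a b c d).re = a := rfl

@[simp] theorem Quaternion.imI_ofCoords (a b c d : ℚ) : (ofCoords a b c d).imI = b := rfl

@[simp] theorem Quaternion.imJ_ofCoords (a b c d : ℚ) : (ofCoords a b c d).imJ = c := rfl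

@[simp] theorem Quaternion.imK_ofCoords (a b c d : ℚ) : (ofCoords a b c d).imK = d := rfl

namespace QuaternionGroup

/-- The real parts of the powers of the imaginary unit. -/
def cosQuarter : ZMod 4 → ℤ := ![1, 0, -1, 0]

/-- The imaginary parts of the powers of the imaginary unit. -/
def sinQuarter : ZMod 4 → ℤ := ![0, 1, 0, -1]

theorem cosQuarter_add : ∀ i j, cosQuarter (i + j) =
    cosQuarter i * cosQuarter j - sinQuarter i * sinQuarter j := by decide

theorem sinQuarter_add : ∀ i j, sinQuarter (i + j) =
    sinQuarter i * cosQuarter j + cosQuarter i * sinQuarter j := by decide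

theorem cosQuarter_neg : ∀ i, cosQuarter (-i) = cosQuarter i := by decide

theorem sinQuarter_neg : ∀ i, sinQuarter (-i) = -sinQuarter i := by decide

/-- The embedding of the quaternion group in the rational quaternions. -/
def toQuaternion : QuaternionGroup 2 →* ℍ[ℚ] where
  toFun
    | a k => Quaternion.ofCoords (cosQuarter k) (sinQuarter k) 0 0
    | xa k => Quaternion.ofCoords 0 0 (cosQuarter k) (-sinQuarter k)
  map_one' := by
    rw [one_def]
    ext <;> simp [cosQuarter, sinQuarter]
  map_mul' := by
    have hc2 : cosQuarter 2 = -1 := by decide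
    have hs2 : sinQuarter 2 = 0 := by decide
    rintro (i | i) (j | j)
    · rw [a_mul_a]
      ext <;> simp [cosQuarter_add, sinQuarter_add]; ring
    · rw [a_mul_xa]
      ext <;> simp [sub_eq_add_neg, cosQuarter_add, sinQuarter_add, cosQuarter_neg,
        sinQuarter_neg] <;> ring
    · rw [xa_mul_a]
      ext <;> simp [cosQuarter_add, sinQuarter_add]; ring
    · rw [xa_mul_xa]
      ext <;> simp [sub_eq_add_neg, cosQuarter_add, sinQuarter_add, cosQuarter_neg,
        sinQuarter_neg, hc2, hs2] <;> ring

/-- The linear characters of the quaternion group. -/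
def signHom (u v : ℤˣ) : QuaternionGroup 2 →* ℤˣ where
  toFun
    | a k => u ^ k.val
    | xa k => v * u ^ k.val
  map_one' := by revert u v; decide
  map_mul' := by revert u v; decide

theorem delta_eq_sum_characters (q : QuaternionGroup 2) :
    (if q = 1 then 1 else 0 : ℚ) = 1 / 8 * ((signHom 1 1 q : ℤ) + (signHom (-1) 1 q : ℤ) +
      (signHom 1 (-1) q : ℤ) + (signHom (-1) (-1) q : ℤ) + 4 * (toQuaternion q).re) := by
  have h : ∀ k : ZMod (2 * 2), (if a k = 1 then 8 else 0 : ℤ) = signHom 1 1 (a k) +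
      signHom (-1) 1 (a k) + signHom 1 (-1) (a k) + signHom (-1) (-1) (a k) +
        4 * cosQuarter k := by decide
  have h' : ∀ k : ZMod (2 * 2), (if xa k = 1 then 8 else 0 : ℤ) = signHom 1 1 (xa k) +
      signHom (-1) 1 (xa k) + signHom 1 (-1) (xa k) + signHom (-1) (-1) (xa k) := by decide
  rcases q with k | k
  · have h1 := congrArg (Int.cast (R := ℚ)) (h k)
    have h2 : (toQuaternion (a k)).re = cosQuarter k := rfl
    rw [h2]
    push_cast at h1
    rw [← h1]
    split_ifs <;> norm_num
  · have h1 := congrArg (Int.cast (R := ℚ)) (h' k)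
    have h2 : (toQuaternion (xa k)).re = 0 := rfl
    rw [h2, mul_zero, add_zero]
    push_cast at h1
    rw [← h1]
    split_ifs <;> norm_num

end QuaternionGroup

/-- The span of the real parts of the quaternionic representations of degree one. -/
def quaternionCharacterSpan (E : Type*) [Group E] : Submodule ℚ (E → ℚ) :=
  Submodule.span ℚ (Set.range fun (ρ : E →* ℍ[ℚ]) e => (ρ e).re)

theorem QuaternionGroup.delta_mem_quaternionCharacterSpan :
    (fun q : QuaternionGroup 2 => if q = 1 then 1 else 0) ∈
      quaternionCharacterSpan (QuaternionGroup 2) := by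
  have hsign : ∀ u v : ℤˣ, (fun q => ((QuaternionGroup.signHom u v q : ℤ) : ℚ)) ∈
      quaternionCharacterSpan (QuaternionGroup 2) := fun u v =>
    Submodule.subset_span ⟨((algebraMap ℚ ℍ[ℚ]).comp (Int.castRingHom ℚ) : ℤ →* ℍ[ℚ]).comp
      ((Units.coeHom ℤ).comp (QuaternionGroup.signHom u v)), by ext q; rfl⟩
  have hquat : (fun q => (QuaternionGroup.toQuaternion q).re) ∈
      quaternionCharacterSpan (QuaternionGroup 2) := Submodule.subset_span ⟨_, rfl⟩
  convert (quaternionCharacterSpan (QuaternionGroup 2)).smul_mem (1 / 8)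
    (add_mem (add_mem (add_mem (add_mem (hsign 1 1) (hsign (-1) 1)) (hsign 1 (-1)))
      (hsign (-1) (-1))) ((quaternionCharacterSpan (QuaternionGroup 2)).smul_mem 4 hquat))
    using 1
  ext q
  rw [delta_eq_sum_characters]
  rfl

/-- The sign character of the cyclic group of order two. -/
def signTwo : Multiplicative (ZMod 2) →* ℤˣ where
  toFun x := if x = 1 then 1 else -1
  map_one' := rfl
  map_mul' := by decide

theorem delta_mem_span_characters (ι : Type*) [Fintype ι] [DecidableEq ι] :
    (fun c : ι → Multiplicative (ZMod 2) => if c = 1 then 1 else 0) ∈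
      Submodule.span ℚ (Set.range fun (χ : (ι → Multiplicative (ZMod 2)) →* ℚ) c => χ c) := by
  let σ : Multiplicative (ZMod 2) →* ℚ :=
    (Int.castRingHom ℚ : ℤ →* ℚ).comp ((Units.coeHom ℤ).comp signTwo)
  have hσ : ∀ x, (if x = 1 then 2 else 0 : ℚ) = 1 + σ x := by
    have : ∀ x, (if x = 1 then 2 else 0 : ℤ) = 1 + signTwo x := by decide
    intro x
    have h := congrArg (Int.cast (R := ℚ)) (this x)
    push_cast at h
    exact h
  have key : (fun c : ι → Multiplicative (ZMod 2) => if c = 1 then 1 else 0) =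
      (2 ^ Fintype.card ι : ℚ)⁻¹ • ∑ s ∈ Finset.univ.powerset, fun c =>
        (∏ i ∈ s, σ.comp (Pi.evalMonoidHom (fun _ : ι => Multiplicative (ZMod 2)) i)) c := by
    ext c
    rw [Pi.smul_apply, Finset.sum_apply]
    simp only [MonoidHom.finsetProd_apply]
    simp only [MonoidHom.comp_apply, Pi.evalMonoidHom_apply, ← Finset.prod_one_add, ← hσ]
    split_ifs with h
    · subst h
      simp
    · obtain ⟨i, hi⟩ := Function.ne_iff.mp h
      rw [Finset.prod_eq_zero (Finset.mem_univ i) (if_neg hi), smul_zero]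
  rw [key]
  exact Submodule.smul_mem _ _ (Submodule.sum_mem _ fun s _ => Submodule.subset_span ⟨_, rfl⟩)

theorem mul_mem_quaternionCharacterSpan {E F : Type*} [Group E] [Group F] {f : E → ℚ}
    {g : F → ℚ} (hf : f ∈ quaternionCharacterSpan E)
    (hg : g ∈ Submodule.span ℚ (Set.range fun (χ : F →* ℚ) c => χ c)) :
    (fun x : E × F => f x.1 * g x.2) ∈ quaternionCharacterSpan (E × F) := by
  induction hg using Submodule.span_induction with
  | zero => simp only [Pi.zero_apply, mul_zero]; exact Submodule.zero_mem _
  | add g g' _ _ h h' => simp only [Pi.add_apply, mul_add]; exact add_mem h h'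
  | smul c g _ h =>
    convert (quaternionCharacterSpan (E × F)).smul_mem c h using 1
    ext x; simp; ring
  | mem g hg =>
    obtain ⟨χ, rfl⟩ := hg
    induction hf using Submodule.span_induction with
    | zero => simp only [Pi.zero_apply, zero_mul]; exact Submodule.zero_mem _
    | add g g' _ _ h h' => simp only [Pi.add_apply, add_mul]; exact add_mem h h'
    | smul c g _ h =>
      convert (quaternionCharacterSpan (E × F)).smul_mem c h using 1
      ext x; simp; ring
    | mem f hf =>
      obtain ⟨ρ, rfl⟩ := hf
      refine Submodule.subset_span ⟨⟨⟨fun x => χ x.2 • ρ x.1, by simp⟩, fun x y => ?_⟩, ?_⟩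
      · simp [smul_smul, mul_comm]
      · ext x
        simp [mul_comm]

/-- The functional of evaluation at the identity is a combination of real parts of quaternionic
representations. -/
theorem delta_mem_quaternionCharacterSpan (ι : Type*) [Fintype ι] [DecidableEq ι] :
    (fun e : QuaternionGroup 2 × (ι → Multiplicative (ZMod 2)) => if e = 1 then 1 else 0) ∈
      quaternionCharacterSpan (QuaternionGroup 2 × (ι → Multiplicative (ZMod 2))) := by
  convert mul_mem_quaternionCharacterSpan QuaternionGroup.delta_mem_quaternionCharacterSpan
    (delta_mem_span_characters ι) using 2 with e
  rcases e with ⟨q, c⟩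
  by_cases hq : q = 1 <;> simp [Prod.ext_iff, hq]

section
variable {G E H B : Type*} [Group G] [Group E] [Group H] [Ring B] [Algebra ℚ B]

/-- The algebra map `ℚ[G] → B ⊗ ℍ` attached to a map `ℚ[H] → B` and a quaternionic
representation of `E`, for `G` mapping to `E` and `H`. -/
noncomputable def tensorQuaternionHom (α : G →* E) (β : G →* H) (ρ : E →* ℍ[ℚ])
    (π : MonoidAlgebra ℚ H →ₐ[ℚ] B) : MonoidAlgebra ℚ G →ₐ[ℚ] B ⊗[ℚ] ℍ[ℚ] :=
  MonoidAlgebra.lift ℚ _ G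
    { toFun := fun g => π (MonoidAlgebra.of ℚ H (β g)) ⊗ₜ ρ (α g)
      map_one' := by simp only [map_one, Algebra.TensorProduct.one_def]
      map_mul' := fun g g' => by
        simp only [map_mul, Algebra.TensorProduct.tmul_mul_tmul] }

theorem tensorQuaternionHom_single (α : G →* E) (β : G →* H) (ρ : E →* ℍ[ℚ])
    (π : MonoidAlgebra ℚ H →ₐ[ℚ] B) (g : G) (c : ℚ) :
    tensorQuaternionHom α β ρ π (MonoidAlgebra.single g c) =
      c • (π (MonoidAlgebra.single (β g) 1) ⊗ₜ ρ (α g)) := by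
  rw [tensorQuaternionHom, MonoidAlgebra.lift_single]
  rfl

theorem tensorQuaternionHom_apply [Fintype G] (α : G →* E) (β : G →* H) (ρ : E →* ℍ[ℚ])
    (π : MonoidAlgebra ℚ H →ₐ[ℚ] B) (y : MonoidAlgebra ℚ G) :
    tensorQuaternionHom α β ρ π y =
      ∑ g, y.coeff g • (π (MonoidAlgebra.single (β g) 1) ⊗ₜ ρ (α g)) := by
  conv_lhs => rw [← MonoidAlgebra.sum_coeff_single y]
  rw [Finsupp.sum_fintype _ _ (by simp), map_sum]
  simp only [tensorQuaternionHom_single]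

end

theorem eq_zero_of_tensorQuaternionHom {G E H : Type*} [Group G] [Finite G] [Group E] [Group H]
    {n : ℕ} {B : Fin n → Type*} [∀ i, Ring (B i)] [∀ i, Algebra ℚ (B i)]
    (e : MonoidAlgebra ℚ H ≃ₐ[ℚ] ∀ i, B i) (α : G →* E) (β : G →* H)
    (hinj : ∀ g, α g = 1 → β g = 1 → g = 1) [DecidableEq E]
    (hE : (fun e : E => if e = 1 then 1 else 0) ∈ quaternionCharacterSpan E)
    (y : MonoidAlgebra ℚ G)
    (hy : ∀ (ρ : E →* ℍ[ℚ]) (i : Fin n),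
      tensorQuaternionHom α β ρ ((Pi.evalAlgHom ℚ B i).comp e.toAlgHom) y = 0) : y = 0 := by
  classical
  have := Fintype.ofFinite G
  have key : ∀ y : MonoidAlgebra ℚ G, (∀ (ρ : E →* ℍ[ℚ]) (i : Fin n),
      tensorQuaternionHom α β ρ ((Pi.evalAlgHom ℚ B i).comp e.toAlgHom) y = 0) →
      y.coeff 1 = 0 := by
    intro y hy
    have hspan : ∀ f ∈ quaternionCharacterSpan E,
        ∑ g, y.coeff g * ((if β g = 1 then 1 else 0) * f (α g)) = 0 := by
      intro f hf
      induction hf using Submodule.span_induction with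
      | zero => simp
      | add f f' _ _ h h' =>
        simp only [Pi.add_apply, mul_add, Finset.sum_add_distrib, h, h', add_zero]
      | smul c f _ h =>
        simp only [Pi.smul_apply, smul_eq_mul]
        refine Eq.trans ?_ (congrArg (c * ·) h |>.trans (mul_zero c))
        simp only [Finset.mul_sum]
        exact Finset.sum_congr rfl fun g _ => by ring
      | mem f hf =>
        obtain ⟨ρ, rfl⟩ := hf
        let re : ℍ[ℚ] →ₗ[ℚ] ℚ :=
          { toFun := fun q => q.re, map_add' := fun _ _ => rfl, map_smul' := fun _ _ => rfl }
        let c1 : MonoidAlgebra ℚ H →ₗ[ℚ] ℚ :=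
          { toFun := fun z => z.coeff 1, map_add' := fun _ _ => rfl, map_smul' := fun _ _ => rfl }
        let T : ∀ i, B i ⊗[ℚ] ℍ[ℚ] →ₗ[ℚ] ℚ := fun i => LinearMap.mul' ℚ ℚ ∘ₗ
          TensorProduct.map (c1 ∘ₗ e.symm.toLinearMap ∘ₗ LinearMap.single ℚ B i) re
        have h : ∑ i, T i (tensorQuaternionHom α β ρ
            ((Pi.evalAlgHom ℚ B i).comp e.toAlgHom) y) = 0 :=
          Finset.sum_eq_zero fun i _ => by rw [hy, map_zero]
        refine Eq.trans ?_ h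
        simp only [tensorQuaternionHom_apply, map_sum, map_smul]
        rw [Finset.sum_comm]
        refine Finset.sum_congr rfl fun g _ => ?_
        rw [← Finset.smul_sum, smul_eq_mul]
        congr 1
        have h2 : ∀ i, T i (((Pi.evalAlgHom ℚ B i).comp e.toAlgHom)
            (MonoidAlgebra.single (β g) 1) ⊗ₜ ρ (α g)) =
            c1 (e.symm (Pi.single i (e (MonoidAlgebra.single (β g) 1) i))) * (ρ (α g)).re :=
          fun i => rfl
        simp only [h2]
        rw [← Finset.sum_mul, ← map_sum, ← map_sum, Finset.univ_sum_single, e.symm_apply_apply]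
        congr 1
        change _ = (MonoidAlgebra.single (β g) (1 : ℚ)).coeff 1
        rw [MonoidAlgebra.coeff_single, Finsupp.single_apply]
    have h := hspan _ hE
    rw [Finset.sum_eq_single 1] at h
    · simpa using h
    · intro g _ hg
      by_cases h1 : β g = 1
      · rw [if_neg fun h2 => hg (hinj g h2 h1), mul_zero, mul_zero]
      · rw [if_neg h1, zero_mul, mul_zero]
    · simp
  apply MonoidAlgebra.coeff_injective
  ext g
  have h := key (y * MonoidAlgebra.single g⁻¹ 1) fun ρ i => by rw [map_mul, hy, zero_mul]
  rw [MonoidAlgebra.coeff_mul_single_apply] at h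
  simpa using h

theorem nonempty_matrix_algEquiv (D : Type*) [Ring D] [Algebra ℚ D] {n : ℕ} (hn : n = 1) :
    Nonempty (Matrix (Fin n) (Fin n) D ≃ₐ[ℚ] D) := by
  subst hn
  refine ⟨(AlgEquiv.ofBijective (Matrix.scalarAlgHom (Fin 1) ℚ) ⟨fun a b h => ?_,
    fun A => ⟨A 0 0, ?_⟩⟩).symm⟩
  · simpa using congrFun (congrFun h 0) 0
  · ext i j
    fin_cases i; fin_cases j
    simp

theorem mul_single_eq_self_of_isNilpotent_s18 {G E H : Type*} [Group G] [Finite G] [Group E]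
    [Group H] [Finite H] (hodd : Odd (Nat.card H)) {t : ℕ}
    (ht : Odd t) (hdvd : (Nat.card H : ℤ) ∣ 2 ^ t - 1) (α : G →* E) (β : G →* H)
    (hinj : ∀ g, α g = 1 → β g = 1 → g = 1) [DecidableEq E]
    (hE : (fun e : E => if e = 1 then 1 else 0) ∈ quaternionCharacterSpan E) (m : G)
    (hα : α m = 1)
    (hm : ∀ z : MonoidAlgebra ℚ H, IsNilpotent z → z * MonoidAlgebra.single (β m) 1 = z)
    (x : MonoidAlgebra ℚ G) (hx : IsNilpotent x) : x * MonoidAlgebra.single m 1 = x := by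
  classical
  have : Module.Finite ℚ (MonoidAlgebra ℚ H) :=
    Module.Finite.of_basis (MonoidAlgebra.basis H ℚ)
  have : NeZero (Nat.card H : ℚ) := ⟨by exact_mod_cast Nat.card_pos.ne'⟩
  obtain ⟨n, D, d, _, _, hfin, hd, ⟨e⟩⟩ :=
    IsSemisimpleRing.exists_algEquiv_pi_matrix_divisionRing_finite ℚ (MonoidAlgebra ℚ H)
  rw [← sub_eq_zero]
  refine eq_zero_of_tensorQuaternionHom e α β hinj hE _ fun ρ i => ?_
  set π := (Pi.evalAlgHom ℚ (fun i => Matrix (Fin (d i)) (Fin (d i)) (D i)) i).comp e.toAlgHom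
    with hπ
  have hπe : ∀ z, π z = e z i := fun z => rfl
  have := hd i
  by_cases hdi : d i = 1
  · obtain ⟨u⟩ := nonempty_matrix_algEquiv (D i) hdi
    let s : D i →ₗ[ℚ] MonoidAlgebra ℚ H := e.symm.toLinearMap ∘ₗ
      LinearMap.single ℚ (fun i => Matrix (Fin (d i)) (Fin (d i)) (D i)) i ∘ₗ
        u.symm.toLinearMap
    have hs : ∀ c, s c = e.symm (Pi.single i (u.symm c)) := fun c => rfl
    have h0 := eq_zero_of_isNilpotent_tensor_quaternion hodd ht hdvd (u.toAlgHom.comp π) s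
      (fun c => by
        change u (e (s c) i) = c
        rw [hs, e.apply_symm_apply, Pi.single_eq_same, u.apply_symm_apply])
      (fun z => by
        apply e.injective
        change e (s (u (e z i))) = _
        rw [map_mul, hs, hs, e.apply_symm_apply, e.apply_symm_apply, u.symm_apply_apply, map_one]
        ext j : 1
        by_cases hj : j = i
        · subst hj; simp
        · simp [hj])
      (Algebra.TensorProduct.congr u AlgEquiv.refl (tensorQuaternionHom α β ρ π x))
      ((hx.map (tensorQuaternionHom α β ρ π)).map _)
    have h1 : tensorQuaternionHom α β ρ π x = 0 :=
      (map_eq_zero_iff _ (Algebra.TensorProduct.congr u AlgEquiv.refl).injective).mp h0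
    rw [map_sub, map_mul, h1, zero_mul, sub_zero]
  · have h1 : π (MonoidAlgebra.single (β m) 1) = 1 := by
      ext b c
      have : Nontrivial (Fin (d i)) := Fin.nontrivial_iff_two_le.mpr (by
        have := NeZero.ne (d i); omega)
      obtain ⟨a, hab⟩ := exists_ne b
      have h2 := hm (e.symm (Pi.single i (Matrix.single a b 1))) ⟨2, by
        rw [← map_pow, sq, ← Pi.single_mul, Matrix.single_mul_single_of_ne _ _ _ _ hab.symm]
        simp⟩
      have h3 := congrFun (congrArg e h2) i
      rw [map_mul, e.apply_symm_apply, Pi.mul_apply, Pi.single_eq_same, ← hπe] at h3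
      have h4 := congrFun (congrFun h3 a) c
      rw [Matrix.single_mul_apply_same, one_mul] at h4
      rw [h4, Matrix.one_apply, Matrix.single_apply]
      simp
    rw [map_sub, map_mul, tensorQuaternionHom_single, h1, hα, map_one, one_smul,
      ← Algebra.TensorProduct.one_def, mul_one, sub_self]

theorem aveIdem_mul_single {K G : Type*} [Field K] [Group G] [Finite G] {N : Subgroup G} {n : G}
    (hn : n ∈ N) : aveIdem K N * MonoidAlgebra.single n 1 = aveIdem K N := by
  have := Fintype.ofFinite N
  rw [aveIdem, finsum_eq_sum_of_fintype, smul_mul_assoc, Finset.sum_mul]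
  congr 1
  refine Fintype.sum_equiv (Equiv.mulRight (⟨n, hn⟩ : N)) _ _ fun k => ?_
  simp [MonoidAlgebra.of_apply, MonoidAlgebra.single_mul_single]

theorem isNKW_iff {K G : Type*} [Field K] [CharZero K] [Group G] [Finite G] (N : Subgroup G) :
    IsNKW K N ↔ ∀ x : MonoidAlgebra K G, IsNilpotent x →
      ∀ n ∈ N, x * MonoidAlgebra.single n 1 = x := by
  refine ⟨fun h x hx n hn => ?_, fun h x hx => ?_⟩
  · rw [← h x hx, mul_assoc, aveIdem_mul_single hn]
  · have := Fintype.ofFinite N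
    have hN : (Nat.card N : K) ≠ 0 := Nat.cast_ne_zero.mpr Nat.card_pos.ne'
    have hs : ∑ n : N, x * MonoidAlgebra.of K G (n : G) = (Nat.card N : K) • x := by
      have hx' : ∀ n : N, x * MonoidAlgebra.of K G (n : G) = x := fun n => h x hx n n.2
      simp only [hx', Finset.sum_const, Finset.card_univ, Nat.card_eq_fintype_card,
        Nat.cast_smul_eq_nsmul]
    rw [aveIdem, finsum_eq_sum_of_fintype, mul_smul_comm, Finset.mul_sum, hs, smul_smul,
      inv_mul_cancel₀ hN, one_smul]

/-- If an injective homomorphism pushes a nonzero nilpotent forward, a witness lies in its range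
and pulls back to a witness. -/
theorem exists_normal_isNKW_of_injective {G H : Type*} [Group G] [Finite G] [Group H] [Finite H]
    [Nontrivial H] (ι : H →* G) (hι : Function.Injective ι) {N : Subgroup G} (hN : N.Normal)
    (hbot : N ≠ ⊥) (hW : IsNKW ℚ N) : ∃ M : Subgroup H, M.Normal ∧ M ≠ ⊥ ∧ IsNKW ℚ M := by
  classical
  rw [isNKW_iff] at hW
  have hF : Function.Injective (MonoidAlgebra.mapDomainAlgHom ℚ ℚ ι) := by
    intro x y h
    exact MonoidAlgebra.mapDomain_injective hι h
  have hsingle : ∀ h : H, MonoidAlgebra.mapDomainAlgHom ℚ ℚ ι (MonoidAlgebra.single h 1) =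
      MonoidAlgebra.single (ι h) 1 := fun h => MonoidAlgebra.mapDomain_single
  by_cases hx : ∀ x : MonoidAlgebra ℚ H, IsNilpotent x → x = 0
  · exact ⟨⊤, inferInstance, top_ne_bot, fun x hn => by rw [hx x hn, zero_mul]⟩
  push Not at hx
  obtain ⟨x, hn, hx0⟩ := hx
  have hrange : N ≤ ι.range := by
    intro n hnN
    have h1 := hW _ (hn.map (MonoidAlgebra.mapDomainAlgHom ℚ ℚ ι)) n hnN
    obtain ⟨h, hh⟩ : ∃ h, x.coeff h ≠ 0 := by
      by_contra! hall
      exact hx0 (MonoidAlgebra.coeff_injective (Finsupp.ext hall))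
    have h2 : (MonoidAlgebra.mapDomainAlgHom ℚ ℚ ι x).coeff (ι h) = x.coeff h :=
      Finsupp.mapDomain_apply hι _ _
    have h3 := congrArg (fun y => y.coeff (ι h * n)) h1
    simp only [MonoidAlgebra.coeff_mul_single_apply, mul_inv_cancel_right, mul_one] at h3
    have h4 : ι h * n ∈ ι.range := by
      by_contra hnot
      have h5 : (MonoidAlgebra.mapDomainAlgHom ℚ ℚ ι x).coeff (ι h * n) = 0 :=
        Finsupp.mapDomain_of_notMem_range _ _ hnot
      rw [h5, h2] at h3
      exact hh h3
    exact (ι.range.mul_mem_cancel_left ⟨h, rfl⟩).mp h4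
  refine ⟨N.comap ι, hN.comap ι, fun hM => hbot ?_, (isNKW_iff _).mpr fun y hy m hm => hF ?_⟩
  · rw [eq_bot_iff]
    intro n hnN
    obtain ⟨h, rfl⟩ := hrange hnN
    have : h ∈ N.comap ι := hnN
    rw [hM, Subgroup.mem_bot] at this
    rw [this, map_one]
    exact Subgroup.one_mem _
  · rw [map_mul, hsingle]
    exact hW _ (hy.map _) _ hm

open Polynomial in
theorem exists_sum_two_sq_eq_one_sub_X_pow (s : ℕ) :
    ∃ A B : ℚ[X], (1 - X ^ 2) * (A ^ 2 + B ^ 2) = 1 - X ^ 2 ^ (s + 1) := by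
  induction s with
  | zero => exact ⟨1, 0, by ring⟩
  | succ s ih =>
    obtain ⟨A, B, h⟩ := ih
    refine ⟨A - B * X ^ 2 ^ s, A * X ^ 2 ^ s + B, ?_⟩
    calc _ = (1 - X ^ 2) * (A ^ 2 + B ^ 2) * (1 + X ^ 2 ^ s * X ^ 2 ^ s) := by ring
      _ = 1 - X ^ 2 ^ (s + 1) * X ^ 2 ^ (s + 1) := by
        rw [h, ← pow_add, ← two_mul, ← pow_succ']; ring
      _ = _ := by rw [← pow_add, ← two_mul, ← pow_succ']

open Polynomial in
/-- If `-1` is a power of `2` modulo the order of `M`, then `-1` is a sum of two squares in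
`ℚ[M]` away from the elements fixed by `M ^ 2`. -/
theorem exists_polynomial_mul_sum_sq_eq_zero {R : Type*} [Ring R] [Algebra ℚ R] {M : R}
    {s : ℕ} (hM : M ^ (2 ^ s + 1) = 1) :
    ∃ A B : ℚ[X], (1 - M ^ 2) * (1 + aeval M A * aeval M A + aeval M B * aeval M B) = 0 := by
  obtain ⟨A, B, h⟩ := exists_sum_two_sq_eq_one_sub_X_pow s
  refine ⟨X * A, X * B, ?_⟩
  have h1 : (1 - X ^ 2) * (1 + (X * A) * (X * A) + (X * B) * (X * B)) =
      1 - (X : ℚ[X]) ^ (2 * (2 ^ s + 1)) := by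
    calc _ = 1 - X ^ 2 + X ^ 2 * ((1 - X ^ 2) * (A ^ 2 + B ^ 2)) := by ring
      _ = _ := by rw [h]; ring
  have h2 := congrArg (aeval M) h1
  simp only [map_mul, map_sub, map_add, map_pow, map_one, aeval_X] at h2
  rw [mul_comm 2, pow_mul, hM, one_pow, sub_self] at h2
  simpa only [map_mul, aeval_X] using h2

theorem quaternionic_sq_eq_zero {R : Type*} [Ring R] {w c I J K a b : R}
    (hw : ∀ y, Commute w y) (hcI : Commute c I) (hcJ : Commute c J) (hcK : Commute c K)
    (hca : Commute c a) (hcb : Commute c b) (haI : Commute a I) (haJ : Commute a J)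
    (haK : Commute a K) (hbI : Commute b I) (hbJ : Commute b J) (hbK : Commute b K)
    (hab : Commute a b) (hI : w * (I * I) = -w) (hJ : w * (J * J) = -w) (hK : w * (K * K) = -w)
    (hIJ : w * (I * J + J * I) = 0) (hIK : w * (I * K + K * I) = 0)
    (hJK : w * (J * K + K * J) = 0) (h0 : c * (1 + a * a + b * b) = 0) :
    (w * c * (I + a * J + b * K)) ^ 2 = 0 := by
  have h1 : (I + a * J + b * K) * (I + a * J + b * K) = I * I + a * (I * J + J * I) +
      b * (I * K + K * I) + a * a * (J * J) + a * b * (J * K + K * J) + b * b * (K * K) := by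
    have e1 : I * (a * J) = a * (I * J) := by rw [← mul_assoc, ← haI.eq, mul_assoc]
    have e2 : I * (b * K) = b * (I * K) := by rw [← mul_assoc, ← hbI.eq, mul_assoc]
    have e3 : a * J * (a * J) = a * a * (J * J) := haJ.symm.mul_mul_mul_comm _ _
    have e4 : a * J * (b * K) = a * b * (J * K) := hbJ.symm.mul_mul_mul_comm _ _
    have e5 : b * K * (a * J) = a * b * (K * J) := by
      rw [haK.symm.mul_mul_mul_comm, hab.eq]
    have e6 : b * K * (b * K) = b * b * (K * K) := hbK.symm.mul_mul_mul_comm _ _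
    simp only [mul_add, add_mul, e1, e2, e3, e4, e5, e6, mul_assoc a J I, mul_assoc b K I]
    abel
  have hwl : ∀ y z, w * (y * z) = y * (w * z) := fun y z => by
    rw [← mul_assoc, (hw y).eq, mul_assoc]
  have h2 : w * ((I + a * J + b * K) * (I + a * J + b * K)) = -(w * (1 + a * a + b * b)) := by
    rw [h1]
    rw [mul_add w, mul_add w, mul_add w, mul_add w, mul_add w, hI, hwl a, hIJ, hwl b, hIK,
      hwl (a * a), hJ, hwl (a * b), hJK, hwl (b * b), hK, mul_add w, mul_add w, (hw (a * a)).eq,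
      (hw (b * b)).eq]
    simp only [mul_zero, mul_neg, mul_one]
    abel
  have hcY : Commute c (I + a * J + b * K) :=
    (hcI.add_right (hca.mul_right hcJ)).add_right (hcb.mul_right hcK)
  have hwcY : Commute (w * c) (I + a * J + b * K) := (hw _).mul_left hcY
  rw [hwcY.mul_pow, sq (I + _ + _), sq]
  simp only [mul_assoc]
  rw [hwl c (_ * (I + a * J + b * K)), h2, mul_neg, ← hwl c, h0, mul_zero, neg_zero,
    mul_zero, mul_zero]

open Polynomial in
theorem eq_bot_of_isNKW_of_two_pow {C H : Type*} [Group C] [Finite C] [Group H] [Finite H]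
    {N : Subgroup (QuaternionGroup 2 × C × H)} (hW : IsNKW ℚ N) {m : H} {s : ℕ}
    (hm : m ^ (2 ^ s + 1) = 1) (hm4 : m ^ 4 ≠ 1) : N = ⊥ := by
  classical
  rw [isNKW_iff] at hW
  let q : QuaternionGroup 2 → MonoidAlgebra ℚ (QuaternionGroup 2 × C × H) :=
    fun x => MonoidAlgebra.single (x, 1, 1) 1
  have hq : ∀ x y, q x * q y = q (x * y) := fun x y => by
    simp [q, MonoidAlgebra.single_mul_single]
  have hq1 : q 1 = 1 := rfl
  let M : MonoidAlgebra ℚ (QuaternionGroup 2 × C × H) := MonoidAlgebra.single (1, 1, m) 1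
  have hMpow : ∀ k : ℕ, M ^ k = MonoidAlgebra.single (1, 1, m ^ k) 1 := fun k => by
    simp [M, MonoidAlgebra.single_pow]
  obtain ⟨A, B, h0⟩ := exists_polynomial_mul_sum_sq_eq_zero (M := M) (s := s) (by
    rw [hMpow, hm]; rfl)
  have hMq : ∀ x, Commute M (q x) := fun x => by
    simp [M, q, Commute, SemiconjBy, MonoidAlgebra.single_mul_single]
  have hAq : ∀ (P : ℚ[X]) x, Commute (aeval M P) (q x) := fun P x => by
    induction P using Polynomial.induction_on' with
    | add P Q h h' => rw [map_add]; exact h.add_left h'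
    | monomial k c =>
      rw [aeval_monomial]
      exact (Algebra.commute_algebraMap_left c _).mul_left ((hMq x).pow_left k)
  have hAA : ∀ P Q : ℚ[X], Commute (aeval M P) (aeval M Q) := fun P Q => by
    rw [Commute, SemiconjBy, ← map_mul, mul_comm, map_mul]
  set w := 1 - q (QuaternionGroup.a 2) with hw
  have hz : ∀ x : QuaternionGroup 2, QuaternionGroup.a 2 * x = x * QuaternionGroup.a 2 := by
    decide
  have hwc : ∀ y, Commute w y := fun y => by
    refine (Commute.one_left y).sub_left ?_
    induction y using MonoidAlgebra.induction_linear with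
    | zero => exact Commute.zero_right _
    | add y y' h h' => exact h.add_right h'
    | single g c =>
      obtain ⟨x, y, h⟩ := g
      simp [q, Commute, SemiconjBy, MonoidAlgebra.single_mul_single, hz]
  set c := 1 - M ^ 2 with hc
  have hcaeval : c = aeval M (1 - X ^ 2 : ℚ[X]) := by simp [hc]
  have hcq : ∀ x, Commute c (q x) := fun x => hcaeval ▸ hAq _ x
  have hcA : ∀ P, Commute c (aeval M P) := fun P => hcaeval ▸ hAA _ P
  have hwneg : w * q (QuaternionGroup.a 2) = -w := by
    rw [hw, sub_mul, one_mul, hq, show QuaternionGroup.a 2 * QuaternionGroup.a 2 =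
      (1 : QuaternionGroup 2) by decide, hq1, neg_sub]
  have hsq : ∀ x y : QuaternionGroup 2, x * y = QuaternionGroup.a 2 → w * (q x * q y) = -w :=
    fun x y h => by rw [hq, h, hwneg]
  have hanti : ∀ x y : QuaternionGroup 2, x * y = QuaternionGroup.a 2 * (y * x) →
      w * (q x * q y + q y * q x) = 0 := fun x y h => by
    rw [hq, hq, h, ← hq, mul_add, ← mul_assoc, hwneg, neg_mul, neg_add_cancel]
  have hnil : ∀ P Q : ℚ[X], c * (1 + aeval M P * aeval M P + aeval M Q * aeval M Q) = 0 →
      IsNilpotent (w * c * (q (QuaternionGroup.a 1) + aeval M P * q (QuaternionGroup.xa 0) +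
        aeval M Q * q (QuaternionGroup.xa 1))) := fun P Q h =>
    ⟨2, quaternionic_sq_eq_zero hwc (hcq _) (hcq _) (hcq _) (hcA _) (hcA _) (hAq _ _) (hAq _ _)
      (hAq _ _) (hAq _ _) (hAq _ _) (hAq _ _) (hAA _ _) (hsq _ _ (by decide))
      (hsq _ _ (by decide)) (hsq _ _ (by decide)) (hanti _ _ (by decide))
      (hanti _ _ (by decide)) (hanti _ _ (by decide)) h⟩
  have hfix : ∀ n ∈ N, w * c * MonoidAlgebra.single n 1 = w * c := fun n hn => by
    have h1 := hW _ (hnil A B h0) n hn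
    have h2 := hW _ (hnil (-A) (-B) (by simpa using h0)) n hn
    have h3 := congrArg₂ (· + ·) h1 h2
    simp only [← add_mul, ← mul_add, map_neg, neg_mul] at h3
    have h4 : q (QuaternionGroup.a 1) + aeval M A * q (QuaternionGroup.xa 0) +
        aeval M B * q (QuaternionGroup.xa 1) + (q (QuaternionGroup.a 1) +
        -(aeval M A * q (QuaternionGroup.xa 0)) + -(aeval M B * q (QuaternionGroup.xa 1))) =
        (2 : ℚ) • q (QuaternionGroup.a 1) := by
      rw [two_smul]; abel
    rw [h4, mul_smul_comm, smul_mul_assoc] at h3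
    have h5 := smul_right_injective _ (two_ne_zero (α := ℚ)) h3
    have hcomm : Commute (w * c) (q (QuaternionGroup.a 1)) := (hwc _).mul_left (hcq _)
    rw [hcomm.eq, mul_assoc] at h5
    have h6 := congrArg (q (QuaternionGroup.a 3) * ·) h5
    simp only [← mul_assoc (q _) (q _), hq] at h6
    rwa [show QuaternionGroup.a 3 * QuaternionGroup.a 1 = (1 : QuaternionGroup 2) by decide, hq1,
      one_mul, one_mul] at h6
  have hwcs : w * c = MonoidAlgebra.single 1 1 - MonoidAlgebra.single (1, 1, m ^ 2) 1 -
      MonoidAlgebra.single (QuaternionGroup.a 2, 1, 1) 1 +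
      MonoidAlgebra.single (QuaternionGroup.a 2, 1, m ^ 2) 1 := by
    rw [hw, hc, hMpow, mul_sub, mul_one, sub_mul, one_mul, ← MonoidAlgebra.one_def]
    simp only [q, MonoidAlgebra.single_mul_single]
    simp
    abel
  have hm2 : m ^ 2 ≠ 1 := fun h => hm4 (by rw [show 4 = 2 * 2 from rfl, pow_mul, h, one_pow])
  have ha2 : QuaternionGroup.a 2 ≠ (1 : QuaternionGroup 2) := by decide
  have hmem : ∀ n ∈ N, n = 1 ∨ n = (QuaternionGroup.a 2, 1, m ^ 2) := fun n hn => by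
    have h := congrArg (fun y => y.coeff n) (hfix n hn)
    simp only [MonoidAlgebra.coeff_mul_single_apply, mul_inv_cancel, mul_one] at h
    rw [hwcs] at h
    by_contra! hcon
    simp only [MonoidAlgebra.coeff_add, MonoidAlgebra.coeff_sub, Finsupp.add_apply,
      Finsupp.sub_apply, MonoidAlgebra.coeff_single, Finsupp.single_apply, hcon.1.symm,
      hcon.2.symm, if_true, if_false] at h
    simp [Prod.ext_iff, hm2, ha2] at h
    split_ifs at h <;> norm_num at h
  rw [eq_bot_iff]
  intro n hn
  rw [Subgroup.mem_bot]
  refine (hmem n hn).resolve_right fun h => ?_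
  rcases hmem _ (N.mul_mem hn hn) with h' | h'
  · rw [h] at h'
    have := congrArg (fun g => g.2.2) h'
    exact hm4 (by simpa [← pow_add] using this)
  · rw [h] at h'
    have := congrArg (fun g => g.1) h'
    revert this
    simp only [Prod.fst_mul]
    decide

theorem stmt18 (r : ℕ) (H : Type*) [Group H] [Finite H] (hnt : Nontrivial H)
    (hodd : Odd (Nat.card H)) :
    (∃ N : Subgroup (QuaternionGroup 2 × (Fin r → Multiplicative (ZMod 2)) × H),
        N.Normal ∧ N ≠ ⊥ ∧ IsNKW ℚ N) ↔
      ((∃ M : Subgroup H, M.Normal ∧ M ≠ ⊥ ∧ IsNKW ℚ M) ∧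
        Odd (orderOf (2 : ZMod (Nat.card H)))) := by
  constructor
  · rintro ⟨N, hN, hbot, hW⟩
    refine ⟨exists_normal_isNKW_of_injective ((MonoidHom.inr _ _).comp (MonoidHom.inr _ H))
      (Function.LeftInverse.injective (g := fun x => x.2.2) fun _ => rfl) hN hbot hW, ?_⟩
    by_contra hord
    have hex : ∃ p, p.Prime ∧ p ∣ Nat.card H ∧ ¬ Odd (orderOf (2 : ZMod p)) := by
      by_contra! hall
      obtain ⟨t, ht, hdvd⟩ := exists_odd_two_pow Nat.card_pos.ne' fun p hp hpd => hall p hp hpd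
      exact hord (odd_orderOf_two_of_dvd ht hdvd)
    obtain ⟨p, hp, hpd, hpo⟩ := hex
    have : Fact p.Prime := ⟨hp⟩
    have hp2 : Odd p := hodd.of_dvd_nat hpd
    have h2 : (2 : ZMod p) ≠ 0 := by
      intro h
      have := (ZMod.natCast_eq_zero_iff 2 p).mp (by exact_mod_cast h)
      rw [(Nat.prime_dvd_prime_iff_eq hp Nat.prime_two).mp this] at hp2
      exact absurd hp2 (by decide)
    obtain ⟨s, hs⟩ := two_pow_eq_neg_one hpo h2
    obtain ⟨m, hm⟩ := exists_prime_orderOf_dvd_card' p hpd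
    refine hbot (eq_bot_of_isNKW_of_two_pow hW (m := m) (s := s) ?_ fun h => ?_)
    · rw [← orderOf_dvd_iff_pow_eq_one, hm, ← ZMod.natCast_eq_zero_iff]
      push_cast
      rw [hs, neg_add_cancel]
    · rw [← orderOf_dvd_iff_pow_eq_one, hm] at h
      have := (hp.dvd_of_dvd_pow (show p ∣ 2 ^ 2 from h))
      rw [(Nat.prime_dvd_prime_iff_eq hp Nat.prime_two).mp this] at hp2
      exact absurd hp2 (by decide)
  · rintro ⟨⟨M, hM, hbot, hW⟩, hord⟩
    rw [isNKW_iff] at hW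
    have hdvd : (Nat.card H : ℤ) ∣ 2 ^ orderOf (2 : ZMod (Nat.card H)) - 1 := by
      rw [← ZMod.intCast_zmod_eq_zero_iff_dvd]
      push_cast
      rw [pow_orderOf_eq_one, sub_self]
    refine ⟨(⊥ : Subgroup (QuaternionGroup 2)).prod
      ((⊥ : Subgroup (Fin r → Multiplicative (ZMod 2))).prod M), ?_, fun h => hbot ?_, ?_⟩
    · infer_instance
    · rw [eq_bot_iff]
      intro m hm
      have h1 : ((1, 1, m) : QuaternionGroup 2 × (Fin r → Multiplicative (ZMod 2)) × H) ∈
        (⊥ : Subgroup (QuaternionGroup 2)).prod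
          ((⊥ : Subgroup (Fin r → Multiplicative (ZMod 2))).prod M) := by
        simp [Subgroup.mem_prod, hm]
      rw [h, Subgroup.mem_bot] at h1
      simpa using h1
    · rw [isNKW_iff]
      rintro x hx ⟨u, v, m⟩ hn
      simp only [Subgroup.mem_prod, Subgroup.mem_bot] at hn
      obtain ⟨rfl, rfl, hm⟩ := hn
      exact mul_single_eq_self_of_isNilpotent_s18 hodd hord hdvd
        ((MonoidHom.fst _ _).prod ((MonoidHom.fst _ H).comp (MonoidHom.snd _ _)))
        ((MonoidHom.snd _ H).comp (MonoidHom.snd _ _))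
        (fun g h h' => by
          obtain ⟨u, v, m⟩ := g
          simp_all [Prod.ext_iff])
        (delta_mem_quaternionCharacterSpan (Fin r)) _ rfl (fun z hz => hW z hz _ hm) x hx
end
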